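/- Given a Π⁰₁ class P ⊆ 2^ω of positive measure, there is A ∈ P such that A is generalized high (i.e. A' ≡_T (A ⊕ ∅')'), A forms a minimal pair with ∅' (i.e. A is incomputable and every set computable both from A and from ∅' is computable), and A ≤_T ∅''. -/

import Mathlib

/-
Common framework: oracle (relative) partial computability via codes,
Turing reducibility, the jump, Cantor-space measure, Martin-Löf randomness
and genericity relative to an oracle, Turing functionals.
-/

open scoped ENNReal

namespace TypicalDegree

/-- Codes for partial functions recursive in an oracle (Kleene-style),
    following `Nat.Partrec.Code` with an extra `oracle` constructor. -/
inductive OracleCode : Type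
  | zero : OracleCode
  | succ : OracleCode
  | left : OracleCode
  | right : OracleCode
  | oracle : OracleCode
  | pair : OracleCode → OracleCode → OracleCode
  | comp : OracleCode → OracleCode → OracleCode
  | prec : OracleCode → OracleCode → OracleCode
  | rfind' : OracleCode → OracleCode

/-- Evaluation of an oracle code relative to an oracle `g : ℕ →. ℕ`. -/
def OracleCode.eval (g : ℕ →. ℕ) : OracleCode → ℕ →. ℕ
  | .zero => pure 0
  | .succ => Nat.succ
  | .left => ↑fun n : ℕ => n.unpair.1
  | .right => ↑fun n : ℕ => n.unpair.2
  | .oracle => g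
  | .pair cf cg => fun n => Nat.pair <$> OracleCode.eval g cf n <*> OracleCode.eval g cg n
  | .comp cf cg => fun n => OracleCode.eval g cg n >>= OracleCode.eval g cf
  | .prec cf cg =>
    Nat.unpaired fun a n =>
      n.rec (OracleCode.eval g cf a) fun y IH => do
        let i ← IH
        OracleCode.eval g cg (Nat.pair a (Nat.pair y i))
  | .rfind' cf =>
    Nat.unpaired fun a m =>
      (Nat.rfind fun n => (fun m => m = 0) <$> OracleCode.eval g cf (Nat.pair a (n + m))).map
        (· + m)

/-- An effective injective numbering of oracle codes. -/
def OracleCode.encodeCode : OracleCode → ℕ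
  | .zero => 0
  | .succ => 1
  | .left => 2
  | .right => 3
  | .oracle => 4
  | .pair cf cg => 4 * Nat.pair cf.encodeCode cg.encodeCode + 5
  | .comp cf cg => 4 * Nat.pair cf.encodeCode cg.encodeCode + 6
  | .prec cf cg => 4 * Nat.pair cf.encodeCode cg.encodeCode + 7
  | .rfind' cf => 4 * Nat.pair cf.encodeCode cf.encodeCode + 8

/-- The characteristic (total) oracle of an element of Cantor space. -/
def chi (X : ℕ → Bool) : ℕ →. ℕ := fun n => Part.some (cond (X n) 1 0)

/-- `f` is partial recursive relative to the oracle `g`. -/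
def RedIn (f g : ℕ →. ℕ) : Prop := ∃ c : OracleCode, c.eval g = f

/-- A total function `ℕ → ℕ` viewed as a partial function. -/
def natFun (f : ℕ → ℕ) : ℕ →. ℕ := fun n => Part.some (f n)

/-- Turing reducibility between elements of Cantor space. -/
def TRed (X Y : ℕ → Bool) : Prop := RedIn (chi X) (chi Y)

/-- Turing equivalence. -/
def TEquiv (X Y : ℕ → Bool) : Prop := TRed X Y ∧ TRed Y X

/-- `X` is computable. -/
def ComputableSeq (X : ℕ → Bool) : Prop := TRed X fun _ => false

/-- `f : ℕ → ℕ` is computable. -/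
def ComputableFun (f : ℕ → ℕ) : Prop := RedIn (natFun f) (chi fun _ => false)

/-- The Turing jump of `X`: the halting problem relative to `X`,
    under the numbering `encodeCode`. -/
noncomputable def jump (X : ℕ → Bool) : ℕ → Bool := fun n =>
  @decide (∃ c : OracleCode, c.encodeCode = n ∧ (c.eval (chi X) n).Dom) (Classical.dec _)

/-- `∅'`, the halting problem. -/
noncomputable def zeroJump : ℕ → Bool := jump fun _ => false

/-- `X` extends the finite binary string `σ` (i.e. `σ ⊂ X`). -/
def extendsStr (X : ℕ → Bool) (σ : List Bool) : Prop :=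
  ∀ i : Fin σ.length, X i.1 = σ.get i

/-- `⟦V⟧`: the open set of infinite sequences extending some string in `V`. -/
def openOf (V : Set (List Bool)) : Set (ℕ → Bool) := {X | ∃ σ ∈ V, extendsStr X σ}

/-- The (fair-coin) measure of the open set `⟦V⟧` determined by a set of strings `V`:
    the supremum over `n` of the proportion of length-`n` strings with a prefix in `V`. -/
noncomputable def stringMeasure (V : Set (List Bool)) : ℝ≥0∞ :=
  ⨆ n : ℕ, (Nat.card {f : Fin n → Bool // ∃ σ ∈ V, σ <+: List.ofFn f} : ℝ≥0∞) / 2 ^ n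

/-- The fair-coin (Lebesgue) measure on Cantor space, as the outer measure obtained from
    open coverings by sets of strings; it agrees with Lebesgue measure on measurable sets. -/
noncomputable def cantorMeasure (S : Set (ℕ → Bool)) : ℝ≥0∞ :=
  ⨅ (V : Set (List Bool)) (_ : S ⊆ openOf V), stringMeasure V

/-- `W` is computably enumerable relative to `X`. -/
def CEIn (X : ℕ → Bool) (W : Set (List Bool)) : Prop :=
  ∃ c : OracleCode, ∀ σ : List Bool, σ ∈ W ↔ (c.eval (chi X) (Encodable.encode σ)).Dom

/-- `W` is computably enumerable. -/
def CE (W : Set (List Bool)) : Prop := CEIn (fun _ => false) W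

/-- The c.e. set of strings with index `d`. -/
def ceSetOf (d : OracleCode) : Set (List Bool) :=
  {σ | (d.eval (chi fun _ => false) (Encodable.encode σ)).Dom}

/-- The sequence `V` of sets of strings is uniformly c.e. relative to `X`. -/
def UniformCEIn (X : ℕ → Bool) (V : ℕ → Set (List Bool)) : Prop :=
  ∃ c : OracleCode, ∀ (i : ℕ) (σ : List Bool),
    σ ∈ V i ↔ (c.eval (chi X) (Nat.pair i (Encodable.encode σ))).Dom

/-- A Martin-Löf test relative to `X`. -/
def MLTest (X : ℕ → Bool) (V : ℕ → Set (List Bool)) : Prop :=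
  UniformCEIn X V ∧ ∀ i : ℕ, stringMeasure (V i) < (2 : ℝ≥0∞)⁻¹ ^ i

/-- `Y` is Martin-Löf random relative to `X`. -/
def MLRandomIn (X Y : ℕ → Bool) : Prop :=
  ∀ V : ℕ → Set (List Bool), MLTest X V → ∃ i, Y ∉ openOf (V i)

/-- `Y` is 1-random. -/
def OneRandom (Y : ℕ → Bool) : Prop := MLRandomIn (fun _ => false) Y

/-- `Y` is 2-random: Martin-Löf random relative to `∅'`. -/
def TwoRandom (Y : ℕ → Bool) : Prop := MLRandomIn zeroJump Y

/-- `Y` is weakly 2-random: it avoids every null `Π⁰₂` class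
    (every null intersection of a uniformly c.e. sequence of open sets). -/
def Weak2Random (Y : ℕ → Bool) : Prop :=
  ∀ V : ℕ → Set (List Bool), UniformCEIn (fun _ => false) V →
    cantorMeasure (⋂ i, openOf (V i)) = 0 → Y ∉ ⋂ i, openOf (V i)

/-- `Y` is 1-generic relative to `X`. -/
def OneGenericIn (X Y : ℕ → Bool) : Prop :=
  ∀ W : Set (List Bool), CEIn X W →
    ∃ σ : List Bool, extendsStr Y σ ∧ (σ ∈ W ∨ ∀ τ : List Bool, σ <+: τ → τ ∉ W)

/-- `Y` is 1-generic. -/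
def OneGeneric (Y : ℕ → Bool) : Prop := OneGenericIn (fun _ => false) Y

/-- `Y` is 2-generic: 1-generic relative to `∅'`. -/
def TwoGeneric (Y : ℕ → Bool) : Prop := OneGenericIn zeroJump Y

/-- The Turing functional coded by `c` is total on oracle `X` with value `Y ∈ 2^ω`
    (i.e. `Ψ^X = Y`). -/
def FTotal (c : OracleCode) (X : ℕ → Bool) (Y : ℕ → Bool) : Prop :=
  c.eval (chi X) = chi Y

/-- `Ψ^X ⊇ σ`: the output of the functional `c` on oracle `X` extends the string `σ`. -/
def FExtends (c : OracleCode) (X : ℕ → Bool) (σ : List Bool) : Prop :=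
  ∀ i : Fin σ.length, c.eval (chi X) i.1 = Part.some (cond (σ.get i) 1 0)

/-- `π(Ψ,σ) = μ({X : Ψ^X ⊇ σ})`. -/
noncomputable def piMeasure (c : OracleCode) (σ : List Bool) : ℝ≥0∞ :=
  cantorMeasure {X | FExtends c X σ}

/-- A Turing functional is special if every infinite binary sequence
    in its range is incomputable. -/
def Special (c : OracleCode) : Prop :=
  ∀ X Y : ℕ → Bool, FTotal c X Y → ¬ ComputableSeq Y

/-- The code `c` computes the total function `T` on strings (no oracle). -/
def ComputesFun (c : OracleCode) (T : List Bool → Bool) : Prop :=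
  ∀ σ : List Bool, c.eval (chi fun _ => false) (Encodable.encode σ) = Part.some (cond (T σ) 1 0)

/-- `T` is (the characteristic function of) a tree: closed under prefixes. -/
def IsTree (T : List Bool → Bool) : Prop :=
  ∀ σ τ : List Bool, σ <+: τ → T τ = true → T σ = true

/-- The set of infinite paths through the tree `T`; `Π⁰₁` classes are the
    sets of paths through computable trees. -/
def pathsOf (T : List Bool → Bool) : Set (ℕ → Bool) :=
  {X | ∀ n : ℕ, T (List.ofFn fun i : Fin n => X i.1) = true}

/-- The computable join `X ⊕ Y`. -/
def join (X Y : ℕ → Bool) : ℕ → Bool := fun n =>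
  if n % 2 = 0 then X (n / 2) else Y (n / 2)

/-- A finite string used as a (partial) oracle. -/
def strOracle (τ : List Bool) : ℕ →. ℕ := fun n =>
  if h : n < τ.length then Part.some (cond (τ.get ⟨n, h⟩) 1 0) else Part.none

/-- `Ψ^{τ₀}` and `Ψ^{τ₁}` are incompatible: they give different outputs somewhere. -/
def SplitPair (c : OracleCode) (τ₀ τ₁ : List Bool) : Prop :=
  ∃ (n v₀ v₁ : ℕ), v₀ ∈ c.eval (strOracle τ₀) n ∧ v₁ ∈ c.eval (strOracle τ₁) n ∧ v₀ ≠ v₁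

/-- `(U,V)` is a `Ψ`-splitting above `τ`. -/
def SplittingAbove (c : OracleCode) (τ : List Bool) (U V : Finset (List Bool)) : Prop :=
  (∃ ℓ : ℕ, ∀ σ ∈ U ∪ V, σ.length = ℓ ∧ τ <+: σ) ∧
    ∀ σ₀ ∈ U, ∀ σ₁ ∈ V, SplitPair c σ₀ σ₁

/-- The output sequence `Ψ^X` of the functional `c` on oracle `X`
    (defaults to `false` when not total). -/
noncomputable def outSeq (c : OracleCode) (X : ℕ → Bool) : ℕ → Bool := fun n =>
  @dite _ (∃ Y : ℕ → Bool, FTotal c X Y) (Classical.dec _) (fun h => h.choose n) fun _ => false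

/-- `Ψ^X ↾ n`, as a finite string. -/
noncomputable def outStr (c : OracleCode) (X : ℕ → Bool) (n : ℕ) : List Bool :=
  List.ofFn fun i : Fin n => outSeq c X i.1

/-- The degree of `M` is a minimal Turing degree. -/
def MinimalDeg (M : ℕ → Bool) : Prop :=
  ¬ ComputableSeq M ∧ ∀ Z : ℕ → Bool, TRed Z M → ComputableSeq Z ∨ TRed M Z



section Part1
/-! ## Primitive recursion: automation -/

section PrimrecAutomation
variable {α β γ : Type} [Primcodable α] [Primcodable β] [Primcodable γ]

attribute [fun_prop] Primrec
attribute [fun_prop] Primrec.id Primrec.const Primrec.comp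

@[fun_prop] theorem pr_pair {f : α → β} {g : α → γ} (hf : Primrec f) (hg : Primrec g) :
    Primrec (fun a => (f a, g a)) := hf.pair hg
@[fun_prop] theorem pr_fst {f : α → β × γ} (hf : Primrec f) : Primrec (fun a => (f a).1) :=
  Primrec.fst.comp hf
@[fun_prop] theorem pr_snd {f : α → β × γ} (hf : Primrec f) : Primrec (fun a => (f a).2) :=
  Primrec.snd.comp hf
@[fun_prop] theorem pr_take {f : α → ℕ} {g : α → List β} (hf : Primrec f) (hg : Primrec g) :
    Primrec (fun a => (g a).take (f a)) := Primrec.list_take.comp hf hg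
@[fun_prop] theorem pr_drop {f : α → ℕ} {g : α → List β} (hf : Primrec f) (hg : Primrec g) :
    Primrec (fun a => (g a).drop (f a)) := Primrec.list_drop.comp hf hg
@[fun_prop] theorem pr_get {f : α → ℕ} {g : α → List β} (hf : Primrec f) (hg : Primrec g) :
    Primrec (fun a => (g a)[f a]?) := Primrec.list_getElem?.comp hg hf
@[fun_prop] theorem pr_len {g : α → List β} (hg : Primrec g) :
    Primrec (fun a => (g a).length) := Primrec.list_length.comp hg
@[fun_prop] theorem pr_add {f g : α → ℕ} (hf : Primrec f) (hg : Primrec g) :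
    Primrec (fun a => f a + g a) := Primrec.nat_add.comp hf hg
@[fun_prop] theorem pr_mul {f g : α → ℕ} (hf : Primrec f) (hg : Primrec g) :
    Primrec (fun a => f a * g a) := Primrec.nat_mul.comp hf hg
@[fun_prop] theorem pr_sub {f g : α → ℕ} (hf : Primrec f) (hg : Primrec g) :
    Primrec (fun a => f a - g a) := Primrec.nat_sub.comp hf hg
@[fun_prop] theorem pr_div {f g : α → ℕ} (hf : Primrec f) (hg : Primrec g) :
    Primrec (fun a => f a / g a) := Primrec.nat_div.comp hf hg
@[fun_prop] theorem pr_mod {f g : α → ℕ} (hf : Primrec f) (hg : Primrec g) :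
    Primrec (fun a => f a % g a) := Primrec.nat_mod.comp hf hg
@[fun_prop] theorem pr_pow {f g : α → ℕ} (hf : Primrec f) (hg : Primrec g) :
    Primrec (fun a => f a ^ g a) :=
  (Primrec₂.unpaired'.1 Nat.Primrec.pow).comp hf hg
@[fun_prop] theorem pr_natPair {f g : α → ℕ} (hf : Primrec f) (hg : Primrec g) :
    Primrec (fun a => Nat.pair (f a) (g a)) := Primrec₂.natPair.comp hf hg
@[fun_prop] theorem pr_unpair {f : α → ℕ} (hf : Primrec f) :
    Primrec (fun a => Nat.unpair (f a)) := Primrec.unpair.comp hf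
@[fun_prop] theorem pr_some {f : α → β} (hf : Primrec f) :
    Primrec (fun a => some (f a)) := Primrec.option_some.comp hf
@[fun_prop] theorem pr_encode {f : α → β} (hf : Primrec f) :
    Primrec (fun a => Encodable.encode (f a)) := Primrec.encode.comp hf
@[fun_prop] theorem pr_decode {f : α → ℕ} (hf : Primrec f) :
    Primrec (fun a => (Encodable.decode (f a) : Option β)) := Primrec.decode.comp hf
@[fun_prop] theorem pr_cons {f : α → β} {g : α → List β} (hf : Primrec f) (hg : Primrec g) :
    Primrec (fun a => f a :: g a) := Primrec.list_cons.comp hf hg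
@[fun_prop] theorem pr_range {f : α → ℕ} (hf : Primrec f) :
    Primrec (fun a => List.range (f a)) := Primrec.list_range.comp hf
@[fun_prop] theorem pr_cond {c : α → Bool} {f g : α → β} (hc : Primrec c) (hf : Primrec f)
    (hg : Primrec g) : Primrec (fun a => cond (c a) (f a) (g a)) := Primrec.cond hc hf hg

theorem pp_eq {f g : α → β} (hf : Primrec f) (hg : Primrec g) :
    PrimrecPred (fun a => f a = g a) := Primrec.eq.comp hf hg
theorem pp_lt {f g : α → ℕ} (hf : Primrec f) (hg : Primrec g) :
    PrimrecPred (fun a => f a < g a) := Primrec.nat_lt.comp hf hg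
theorem pp_le {f g : α → ℕ} (hf : Primrec f) (hg : Primrec g) :
    PrimrecPred (fun a => f a ≤ g a) := Primrec.nat_le.comp hf hg

theorem pp_ball {p : α → β → Prop} {f : α → List β} (hp : PrimrecPred fun x : α × β => p x.1 x.2)
    (hf : Primrec f) : PrimrecPred (fun a => ∀ b ∈ f a, p a b) := by
  have h : PrimrecRel (fun (b : β) (a : α) => p a b) :=
    PrimrecPred.comp (f := fun x : β × α => (x.2, x.1)) hp (by fun_prop)
  exact h.forall_mem_list.comp hf Primrec.id

theorem pp_bex {p : α → β → Prop} {f : α → List β} (hp : PrimrecPred fun x : α × β => p x.1 x.2)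
    (hf : Primrec f) : PrimrecPred (fun a => ∃ b ∈ f a, p a b) := by
  have h : PrimrecRel (fun (b : β) (a : α) => p a b) :=
    PrimrecPred.comp (f := fun x : β × α => (x.2, x.1)) hp (by fun_prop)
  exact h.exists_mem_list.comp hf Primrec.id

theorem pp_all_lt {p : α → ℕ → Prop} {f : α → ℕ} (hp : PrimrecPred fun x : α × ℕ => p x.1 x.2)
    (hf : Primrec f) : PrimrecPred (fun a => ∀ i < f a, p a i) :=
  (pp_ball hp (Primrec.list_range.comp hf)).of_eq (by simp)

theorem pp_ex_lt {p : α → ℕ → Prop} {f : α → ℕ} (hp : PrimrecPred fun x : α × ℕ => p x.1 x.2)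
    (hf : Primrec f) : PrimrecPred (fun a => ∃ i < f a, p a i) :=
  (pp_bex hp (Primrec.list_range.comp hf)).of_eq (by simp)

end PrimrecAutomation

/-! ## Initial segments -/

/-- The initial segment of length `k`. -/
def pre (X : ℕ → Bool) (k : ℕ) : List Bool := (List.range k).map X

@[simp] theorem pre_length (X : ℕ → Bool) (k : ℕ) : (pre X k).length = k := by simp [pre]

theorem pre_take (X : ℕ → Bool) {j k : ℕ} (h : j ≤ k) : (pre X k).take j = pre X j := by
  unfold pre
  rw [← List.map_take, List.take_range, min_eq_left h]

theorem pre_get (X : ℕ → Bool) {i k : ℕ} (h : i < k) : (pre X k)[i]? = some (X i) := by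
  simp [pre, h]

theorem pre_eq_iff (X : ℕ → Bool) (σ : List Bool) :
    pre X σ.length = σ ↔ ∀ i < σ.length, σ[i]? = some (X i) := by
  constructor
  · intro h i hi
    rw [← h]; exact pre_get X hi
  · intro h
    apply List.ext_getElem?
    intro i
    by_cases hi : i < σ.length
    · rw [pre_get X hi, h i hi]
    · simp [pre, hi]
      try omega

theorem pre_ofFn (X : ℕ → Bool) (n : ℕ) : (List.ofFn fun i : Fin n => X i.1) = pre X n := by
  apply List.ext_getElem <;> simp [pre]

theorem extendsStr_iff (X : ℕ → Bool) (σ : List Bool) : extendsStr X σ ↔ pre X σ.length = σ := by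
  rw [pre_eq_iff]
  constructor
  · intro h i hi
    have := h ⟨i, hi⟩
    simp [this, hi]
  · intro h i
    have := h i.1 i.2
    simp at this
    simp [this]

/-! ## Effectively open predicates, uniformly in the oracle -/

/-- `p X a` is uniformly `Σ⁰₁(X)` for all oracles `X ∈ S`. -/
def Sg (S : Set (ℕ → Bool)) {α : Type} [Primcodable α] (p : (ℕ → Bool) → α → Prop) : Prop :=
  ∃ R : α × List Bool → Prop, PrimrecPred R ∧ ∀ X ∈ S, ∀ a, p X a ↔ ∃ k, R (a, pre X k)

section Sg
variable {S : Set (ℕ → Bool)} {α β γ : Type} [Primcodable α] [Primcodable β] [Primcodable γ]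
  {p q : (ℕ → Bool) → α → Prop}

theorem Sg.congr (h : Sg S p) (e : ∀ X ∈ S, ∀ a, q X a ↔ p X a) : Sg S q := by
  obtain ⟨R, hR, H⟩ := h
  exact ⟨R, hR, fun X hX a => (e X hX a).trans (H X hX a)⟩

theorem Sg.subset {S' : Set (ℕ → Bool)} (h : Sg S p) (e : S' ⊆ S) : Sg S' p := by
  obtain ⟨R, hR, H⟩ := h
  exact ⟨R, hR, fun X hX a => H X (e hX) a⟩

theorem Sg.comp {f : β → α} (h : Sg S p) (hf : Primrec f) : Sg S (fun X b => p X (f b)) := by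
  obtain ⟨R, hR, H⟩ := h
  exact ⟨fun x => R (f x.1, x.2), hR.comp (by fun_prop), fun X hX a => H X hX _⟩

theorem Sg.of_pred {p : α → Prop} (h : PrimrecPred p) : Sg S (fun _ a => p a) :=
  ⟨fun x => p x.1, h.comp (by fun_prop), fun X hX a => by simp⟩

theorem Sg.bit : Sg S (fun X (a : ℕ × Bool) => X a.1 = a.2) := by
  refine ⟨fun x => x.2[x.1.1]? = some x.1.2, pp_eq (by fun_prop) (by fun_prop), ?_⟩
  rintro X - ⟨n, b⟩
  constructor
  · intro h
    exact ⟨n + 1, (pre_get X (Nat.lt_succ_self n)).trans (congrArg some h)⟩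
  · rintro ⟨k, h⟩
    by_cases hn : n < k
    · simpa [pre_get X hn] using h
    · simp [pre, hn] at h

/-- Normal form with a matrix monotone along initial segments. -/
theorem Sg.mono (h : Sg S p) : ∃ R : α × List Bool → Prop, PrimrecPred R ∧
    (∀ X ∈ S, ∀ a, p X a ↔ ∃ k, R (a, pre X k)) ∧
    ∀ X a j k, j ≤ k → R (a, pre X j) → R (a, pre X k) := by
  obtain ⟨R, hR, H⟩ := h
  refine ⟨fun x => ∃ j < x.2.length + 1, R (x.1, x.2.take j), ?_, ?_, ?_⟩
  · refine pp_ex_lt (p := fun (x : α × List Bool) j => R (x.1, x.2.take j)) (hR.comp ?_) ?_ <;> fun_prop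
  · intro X hX a
    rw [H X hX a]
    constructor
    · rintro ⟨k, hk⟩
      exact ⟨k, k, by simp, by simpa [pre_take X le_rfl] using hk⟩
    · rintro ⟨k, j, hj, h⟩
      simp at hj h
      rw [pre_take X (by omega)] at h
      exact ⟨j, h⟩
  · rintro X a j k hjk ⟨i, hi, h⟩
    simp at hi h ⊢
    rw [pre_take X (by omega)] at h
    exact ⟨i, by omega, by rwa [pre_take X (by omega)]⟩

theorem Sg.and (hp : Sg S p) (hq : Sg S q) : Sg S (fun X a => p X a ∧ q X a) := by
  obtain ⟨R, hR, H, M⟩ := hp.mono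
  obtain ⟨R', hR', H', M'⟩ := hq.mono
  refine ⟨fun x => R x ∧ R' x, hR.and hR', fun X hX a => ?_⟩
  beta_reduce
  rw [H X hX a, H' X hX a]
  constructor
  · rintro ⟨⟨k, hk⟩, ⟨l, hl⟩⟩
    exact ⟨max k l, M X a _ _ (le_max_left _ _) hk, M' X a _ _ (le_max_right _ _) hl⟩
  · rintro ⟨k, h, h'⟩
    exact ⟨⟨k, h⟩, ⟨k, h'⟩⟩

theorem Sg.or (hp : Sg S p) (hq : Sg S q) : Sg S (fun X a => p X a ∨ q X a) := by
  obtain ⟨R, hR, H⟩ := hp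
  obtain ⟨R', hR', H'⟩ := hq
  refine ⟨fun x => R x ∨ R' x, hR.or hR', fun X hX a => ?_⟩
  beta_reduce
  rw [H X hX a, H' X hX a, exists_or]

theorem Sg.ex {p : (ℕ → Bool) → α → β → Prop} (hp : Sg S fun X (x : α × β) => p X x.1 x.2) :
    Sg S (fun X a => ∃ b, p X a b) := by
  obtain ⟨R, hR, H, M⟩ := hp.mono
  refine ⟨fun x => ∃ i < x.2.length, ∃ b ∈ (Encodable.decode (α := β) i).toList, R ((x.1, b), x.2),
    ?_, ?_⟩
  · refine pp_ex_lt (p := fun (x : α × List Bool) i =>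
      ∃ b ∈ (Encodable.decode (α := β) i).toList, R ((x.1, b), x.2)) ?_ (by fun_prop)
    refine pp_bex (p := fun (y : (α × List Bool) × ℕ) (b : β) => R ((y.1.1, b), y.1.2))
      (f := fun y => (Encodable.decode (α := β) y.2).toList) (hR.comp (by fun_prop)) ?_
    have : Primrec (fun o : Option β => o.toList) :=
      (Primrec.option_casesOn (o := fun o : Option β => o) Primrec.id (Primrec.const [])
        (g := fun _ b => [b]) (Primrec.list_cons.comp Primrec.snd (Primrec.const []))).of_eq
        (by rintro (_ | _) <;> rfl)
    exact this.comp (by fun_prop)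
  · intro X hX a
    constructor
    · rintro ⟨b, hb⟩
      obtain ⟨k, hk⟩ := (H X hX (a, b)).1 hb
      refine ⟨max k (Encodable.encode b + 1), Encodable.encode b, by simp, b, by simp, ?_⟩
      exact M X _ _ _ (le_max_left _ _) hk
    · rintro ⟨k, i, -, b, -, h⟩
      exact ⟨b, (H X hX (a, b)).2 ⟨k, h⟩⟩

theorem Sg.all_lt {p : (ℕ → Bool) → α → ℕ → Prop} {f : α → ℕ}
    (hp : Sg S fun X (x : α × ℕ) => p X x.1 x.2) (hf : Primrec f) :
    Sg S (fun X a => ∀ i < f a, p X a i) := by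
  obtain ⟨R, hR, H, M⟩ := hp.mono
  refine ⟨fun x => ∀ i < f x.1, R ((x.1, i), x.2), ?_, ?_⟩
  · refine pp_all_lt (p := fun (x : α × List Bool) i => R ((x.1, i), x.2)) (hR.comp ?_) ?_ <;>
      fun_prop
  · intro X hX a
    constructor
    · intro h
      have h2 : ∀ n, (∀ i < n, p X a i) → ∃ k, ∀ i < n, R ((a, i), pre X k) := by
        intro n
        induction n with
        | zero => intro _; exact ⟨0, by simp⟩
        | succ n ih =>
          intro h
          obtain ⟨k, hk⟩ := ih fun i hi => h i (by omega)
          obtain ⟨l, hl⟩ := (H X hX (a, n)).1 (h n (by omega))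
          refine ⟨max k l, fun i hi => ?_⟩
          rcases Nat.lt_succ_iff_lt_or_eq.1 hi with hi | rfl
          · exact M _ _ _ _ (le_max_left _ _) (hk i hi)
          · exact M _ _ _ _ (le_max_right _ _) hl
      exact h2 _ h
    · rintro ⟨k, h⟩ i hi
      exact (H X hX (a, i)).2 ⟨k, h i hi⟩

/-- Bounded universal quantification over the members of a list. -/
theorem Sg.all_mem {p : (ℕ → Bool) → α → β → Prop} {f : α → List β}
    (hp : Sg S fun X (x : α × β) => p X x.1 x.2) (hf : Primrec f) :
    Sg S (fun X a => ∀ b ∈ f a, p X a b) := by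
  have h1 : Sg S (fun X (x : α × ℕ) => ∃ b, (f x.1)[x.2]? = some b ∧ p X x.1 b) := by
    refine Sg.ex (p := fun X (x : α × ℕ) b => (f x.1)[x.2]? = some b ∧ p X x.1 b) ?_
    refine Sg.and (Sg.of_pred (pp_eq (by fun_prop) (by fun_prop))) ?_
    exact hp.comp (f := fun x : (α × ℕ) × β => (x.1.1, x.2)) (by fun_prop)
  refine (Sg.all_lt (p := fun X a i => ∃ b, (f a)[i]? = some b ∧ p X a b)
    (f := fun a => (f a).length) h1 (by fun_prop)).congr ?_
  intro X _ a
  constructor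
  · intro h i hi
    exact ⟨(f a)[i], by simp [hi], h _ (by simp)⟩
  · intro h b hb
    obtain ⟨i, hi, rfl⟩ := List.getElem_of_mem hb
    obtain ⟨b, h1, h2⟩ := h i hi
    simp [hi] at h1
    rwa [h1]

/-- Change of oracle. -/
theorem Sg.trans {X Y : ℕ → Bool} {p : α → Prop}
    (hY : Sg {X} fun _ (a : ℕ × Bool) => Y a.1 = a.2) (hp : Sg {Y} fun _ a => p a) :
    Sg {X} (fun _ a => p a) := by
  obtain ⟨R, hR, H⟩ := hp
  have h1 : Sg {X} (fun _ (x : (α × List Bool) × ℕ) => ∃ b, x.1.2[x.2]? = some b ∧ Y x.2 = b) := by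
    refine Sg.ex (p := fun _ (x : (α × List Bool) × ℕ) b => x.1.2[x.2]? = some b ∧ Y x.2 = b) ?_
    refine Sg.and (Sg.of_pred (pp_eq (by fun_prop) (by fun_prop))) ?_
    exact hY.comp (f := fun x : ((α × List Bool) × ℕ) × Bool => (x.1.2, x.2)) (by fun_prop)
  have h2 : Sg {X} (fun _ (x : α × List Bool) => R x ∧
      ∀ i < x.2.length, ∃ b, x.2[i]? = some b ∧ Y i = b) :=
    Sg.and (Sg.of_pred hR) (Sg.all_lt (p := fun _ (x : α × List Bool) i =>
      ∃ b, x.2[i]? = some b ∧ Y i = b) h1 (by fun_prop))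
  refine (Sg.ex (p := fun _ (a : α) (σ : List Bool) => R (a, σ) ∧
      ∀ i < σ.length, ∃ b, σ[i]? = some b ∧ Y i = b) h2).congr ?_
  intro _ _ a
  refine (H Y rfl a).trans ?_
  constructor
  · rintro ⟨k, hk⟩
    exact ⟨pre Y k, hk, fun i hi => ⟨Y i, pre_get Y (by simpa using hi), rfl⟩⟩
  · rintro ⟨σ, h, h'⟩
    refine ⟨σ.length, ?_⟩
    rw [(pre_eq_iff Y σ).2]
    · exact h
    · intro i hi
      obtain ⟨b, h1, rfl⟩ := h' i hi
      exact h1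

/-- A predicate that is `Σ⁰₁` without oracle is uniformly `Σ⁰₁`. -/
theorem Sg.of_zero {p : α → Prop} (hp : Sg {fun _ => false} fun _ a => p a) :
    Sg S (fun _ a => p a) := by
  obtain ⟨R, hR, H⟩ := hp
  refine ⟨fun x => R (x.1, (List.range x.2.length).map fun _ => false), hR.comp ?_, ?_⟩
  · have : Primrec (fun x : α × List Bool => (List.range x.2.length).map fun _ => false) :=
      Primrec.list_map (by fun_prop) (Primrec.const _)
    fun_prop
  · intro X _ a
    refine (H _ rfl a).trans ?_
    simp [pre]

end Sg

end Part1

section Part2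
/-! ## Universality: computations as finite derivations -/

theorem encodeCode_inj : ∀ c d : OracleCode, c.encodeCode = d.encodeCode → c = d := by
  intro c
  induction c with
  | zero => intro d h; cases d <;> simp [OracleCode.encodeCode] at h ⊢
  | succ => intro d h; cases d <;> simp [OracleCode.encodeCode] at h ⊢
  | left => intro d h; cases d <;> simp [OracleCode.encodeCode] at h ⊢
  | right => intro d h; cases d <;> simp [OracleCode.encodeCode] at h ⊢
  | oracle => intro d h; cases d <;> simp [OracleCode.encodeCode] at h ⊢
  | pair a b iha ihb =>
    intro d h
    cases d <;> simp only [OracleCode.encodeCode] at h <;> try omega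
    have h2 := Nat.pair_eq_pair.1 (Nat.eq_of_mul_eq_mul_left (by norm_num) (Nat.add_right_cancel h))
    rw [iha _ h2.1, ihb _ h2.2]
  | comp a b iha ihb =>
    intro d h
    cases d <;> simp only [OracleCode.encodeCode] at h <;> try omega
    have h2 := Nat.pair_eq_pair.1 (Nat.eq_of_mul_eq_mul_left (by norm_num) (Nat.add_right_cancel h))
    rw [iha _ h2.1, ihb _ h2.2]
  | prec a b iha ihb =>
    intro d h
    cases d <;> simp only [OracleCode.encodeCode] at h <;> try omega
    have h2 := Nat.pair_eq_pair.1 (Nat.eq_of_mul_eq_mul_left (by norm_num) (Nat.add_right_cancel h))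
    rw [iha _ h2.1, ihb _ h2.2]
  | rfind' a iha =>
    intro d h
    cases d <;> simp only [OracleCode.encodeCode] at h <;> try omega
    have h2 := Nat.pair_eq_pair.1 (Nat.eq_of_mul_eq_mul_left (by norm_num) (Nat.add_right_cancel h))
    rw [iha _ h2.1]

theorem encode_prec_inv (c : OracleCode) (a b : ℕ) (h : c.encodeCode = 4 * Nat.pair a b + 7) :
    ∃ f g, c = .prec f g ∧ f.encodeCode = a ∧ g.encodeCode = b := by
  cases c <;> simp only [OracleCode.encodeCode] at h <;> try omega
  have h2 := Nat.pair_eq_pair.1 (Nat.eq_of_mul_eq_mul_left (by norm_num) (Nat.add_right_cancel h))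
  exact ⟨_, _, rfl, h2.1, h2.2⟩

theorem encode_rfind_inv (c : OracleCode) (a : ℕ) (h : c.encodeCode = 4 * Nat.pair a a + 8) :
    ∃ f, c = .rfind' f ∧ f.encodeCode = a := by
  cases c <;> simp only [OracleCode.encodeCode] at h <;> try omega
  have h2 := Nat.pair_eq_pair.1 (Nat.eq_of_mul_eq_mul_left (by norm_num) (Nat.add_right_cancel h))
  exact ⟨_, rfl, h2.1⟩

section evalLemmas
variable (g : ℕ →. ℕ)

theorem mem_eval_pair (cf cg : OracleCode) (n v : ℕ) :
    v ∈ (OracleCode.pair cf cg).eval g n ↔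
      ∃ a ∈ cf.eval g n, ∃ b ∈ cg.eval g n, v = Nat.pair a b := by
  simp [OracleCode.eval, Seq.seq]
  grind

theorem mem_eval_comp (cf cg : OracleCode) (n v : ℕ) :
    v ∈ (OracleCode.comp cf cg).eval g n ↔ ∃ a ∈ cg.eval g n, v ∈ cf.eval g a :=
  Part.mem_bind_iff

theorem eval_prec_zero (cf cg : OracleCode) (a : ℕ) :
    (OracleCode.prec cf cg).eval g (Nat.pair a 0) = cf.eval g a := by
  simp [OracleCode.eval]

theorem mem_eval_prec_succ (cf cg : OracleCode) (a y v : ℕ) :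
    v ∈ (OracleCode.prec cf cg).eval g (Nat.pair a (y + 1)) ↔
      ∃ i ∈ (OracleCode.prec cf cg).eval g (Nat.pair a y),
        v ∈ cg.eval g (Nat.pair a (Nat.pair y i)) := by
  simp [OracleCode.eval]

theorem mem_eval_rfind (cf : OracleCode) (a m v : ℕ) :
    v ∈ (OracleCode.rfind' cf).eval g (Nat.pair a m) ↔
      ∃ k, v = k + m ∧ 0 ∈ cf.eval g (Nat.pair a (k + m)) ∧
        ∀ j < k, ∃ w, w + 1 ∈ cf.eval g (Nat.pair a (j + m)) := by
  have e : (OracleCode.rfind' cf).eval g (Nat.pair a m) =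
      (Nat.rfind fun n => Part.map (fun m => decide (m = 0)) (cf.eval g (Nat.pair a (n + m)))).map
        (· + m) := by
    simp [OracleCode.eval]
  rw [e, Part.mem_map_iff]
  constructor
  · rintro ⟨k, hk, rfl⟩
    replace hk := Nat.mem_rfind.1 hk
    obtain ⟨h0, h1⟩ := hk
    obtain ⟨x, hx, h0⟩ := (Part.mem_map_iff _).1 h0
    refine ⟨k, rfl, ?_, ?_⟩
    · simp at h0; subst h0; exact hx
    · intro j hj
      have h2 := (Part.mem_map_iff _).1 (h1 hj)
      obtain ⟨x, hx, h0⟩ := h2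
      simp at h0
      exact ⟨x - 1, by rwa [Nat.sub_add_cancel (by omega)]⟩
  · rintro ⟨k, rfl, h0, h1⟩
    refine ⟨k, ?_, rfl⟩
    refine Nat.mem_rfind.2 ⟨(Part.mem_map_iff _).2 ⟨0, h0, by simp⟩, ?_⟩
    intro j hj
    obtain ⟨w, hw⟩ := h1 j hj
    exact (Part.mem_map_iff _).2 ⟨w + 1, hw, by simp⟩
end evalLemmas

theorem pp_mem {α β : Type} [Primcodable α] [Primcodable β] {f : α → β} {g : α → List β}
    (hf : Primrec f) (hg : Primrec g) : PrimrecPred (fun a => f a ∈ g a) :=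
  (pp_bex (p := fun a b => b = f a) (f := g) (pp_eq (by fun_prop) (by fun_prop)) hg).of_eq
    (by simp)

/-! ### Finite derivations -/

section Der
variable {α : Type} [Primcodable α]

/-- `L` is a derivation: each entry is justified by the later ones. -/
def Valid (J : α → List α → Prop) (L : List α) : Prop :=
  ∀ i < L.length, ∃ x, L[i]? = some x ∧ J x (L.drop (i + 1))

theorem valid_cons (J : α → List α → Prop) (x : α) (L : List α) :
    Valid J (x :: L) ↔ J x L ∧ Valid J L := by
  constructor
  · intro h
    refine ⟨?_, fun i hi => ?_⟩
    · obtain ⟨y, hy, hj⟩ := h 0 (by simp)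
      simp at hy hj; subst hy; exact hj
    · obtain ⟨y, hy, hj⟩ := h (i + 1) (by simpa using hi)
      exact ⟨y, by simpa using hy, by simpa using hj⟩
  · rintro ⟨h1, h2⟩ i hi
    cases i with
    | zero => exact ⟨x, by simp, by simpa using h1⟩
    | succ i =>
      obtain ⟨y, hy, hj⟩ := h2 i (by simpa using hi)
      exact ⟨y, by simpa using hy, by simpa using hj⟩

/-- Derivability. -/
def Der (J : α → List α → Prop) (x : α) : Prop := ∃ L, Valid J L ∧ x ∈ L

theorem Der.induct {J : α → List α → Prop} {P : α → Prop}
    (h : ∀ x L, J x L → (∀ y ∈ L, P y) → P x) {x : α} (hx : Der J x) : P x := by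
  obtain ⟨L, hL, hx⟩ := hx
  have : ∀ y ∈ L, P y := by
    clear hx
    induction L with
    | nil => simp
    | cons a L ih =>
      rw [valid_cons] at hL
      intro y hy
      rcases List.mem_cons.1 hy with rfl | hy
      · exact h _ _ hL.1 (ih hL.2)
      · exact ih hL.2 y hy
  exact this x hx

theorem Valid.append {J : α → List α → Prop} (hm : ∀ x L M, J x L → L ⊆ M → J x M)
    {L M : List α} (hL : Valid J L) (hM : Valid J M) : Valid J (L ++ M) := by
  induction L with
  | nil => simpa using hM
  | cons a L ih =>
    rw [valid_cons] at hL
    rw [List.cons_append, valid_cons]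
    exact ⟨hm _ _ _ hL.1 (by simp), ih hL.2⟩

theorem Der.intro {J : α → List α → Prop} (hm : ∀ x L M, J x L → L ⊆ M → J x M)
    {x : α} (L : List α) (hJ : J x L) (h : ∀ y ∈ L, Der J y) : Der J x := by
  have : ∃ M, Valid J M ∧ L ⊆ M := by
    clear hJ
    induction L with
    | nil => exact ⟨[], by intro i hi; simp at hi, by simp⟩
    | cons a L ih =>
      obtain ⟨M, hM, hs⟩ := ih fun y hy => h y (by simp [hy])
      obtain ⟨N, hN, ha⟩ := h a (by simp)
      refine ⟨N ++ M, hN.append hm hM, ?_⟩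
      intro y hy
      rcases List.mem_cons.1 hy with rfl | hy
      · simp [ha]
      · simp [hs hy]
  obtain ⟨M, hM, hs⟩ := this
  exact ⟨x :: M, (valid_cons _ _ _).2 ⟨hm _ _ _ hJ hs, hM⟩, by simp⟩

theorem Sg.der {S : Set (ℕ → Bool)} {J : (ℕ → Bool) → α → List α → Prop}
    (h : Sg S fun X (x : α × List α) => J X x.1 x.2) : Sg S (fun X x => Der (J X) x) := by
  refine Sg.ex (p := fun X (x : α) (L : List α) => Valid (J X) L ∧ x ∈ L) ?_
  refine Sg.and ?_ (Sg.of_pred (pp_mem (by fun_prop) (by fun_prop)))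
  refine Sg.all_lt (p := fun X (x : α × List α) i =>
    ∃ y, x.2[i]? = some y ∧ J X y (x.2.drop (i + 1))) ?_ (by fun_prop)
  refine Sg.ex (p := fun X (x : (α × List α) × ℕ) y =>
    x.1.2[x.2]? = some y ∧ J X y (x.1.2.drop (x.2 + 1))) ?_
  refine Sg.and (Sg.of_pred (pp_eq (by fun_prop) (by fun_prop))) ?_
  exact h.comp (f := fun x : ((α × List α) × ℕ) × α => (x.2, x.1.1.2.drop (x.1.2 + 1)))
    (by fun_prop)

end Der

/-- The triple `(e, n, v)` is justified by the triples in `L` (one computation step). -/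
def Just (X : ℕ → Bool) (x : ℕ × ℕ × ℕ) (L : List (ℕ × ℕ × ℕ)) : Prop :=
  (x.1 = 0 ∧ x.2.2 = 0) ∨ (x.1 = 1 ∧ x.2.2 = x.2.1 + 1) ∨
  (x.1 = 2 ∧ x.2.2 = x.2.1.unpair.1) ∨ (x.1 = 3 ∧ x.2.2 = x.2.1.unpair.2) ∨
  (x.1 = 4 ∧ ∃ b : Bool, X x.2.1 = b ∧ x.2.2 = cond b 1 0) ∨
  (∃ u : ℕ × ℕ × ℕ × ℕ, x.1 = 4 * Nat.pair u.1 u.2.1 + 5 ∧ (u.1, x.2.1, u.2.2.1) ∈ L ∧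
    (u.2.1, x.2.1, u.2.2.2) ∈ L ∧ x.2.2 = Nat.pair u.2.2.1 u.2.2.2) ∨
  (∃ u : ℕ × ℕ × ℕ, x.1 = 4 * Nat.pair u.1 u.2.1 + 6 ∧ (u.2.1, x.2.1, u.2.2) ∈ L ∧
    (u.1, u.2.2, x.2.2) ∈ L) ∨
  (∃ u : ℕ × ℕ × ℕ, x.1 = 4 * Nat.pair u.1 u.2.1 + 7 ∧ x.2.1 = Nat.pair u.2.2 0 ∧
    (u.1, u.2.2, x.2.2) ∈ L) ∨
  (∃ u : ℕ × ℕ × ℕ × ℕ × ℕ, x.1 = 4 * Nat.pair u.1 u.2.1 + 7 ∧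
    x.2.1 = Nat.pair u.2.2.1 (u.2.2.2.1 + 1) ∧
    (x.1, Nat.pair u.2.2.1 u.2.2.2.1, u.2.2.2.2) ∈ L ∧
    (u.2.1, Nat.pair u.2.2.1 (Nat.pair u.2.2.2.1 u.2.2.2.2), x.2.2) ∈ L) ∨
  (∃ a : ℕ, x.1 = 4 * Nat.pair a a + 8 ∧ (a, x.2.1, 0) ∈ L ∧ x.2.2 = x.2.1.unpair.2) ∨
  (∃ u : ℕ × ℕ, x.1 = 4 * Nat.pair u.1 u.1 + 8 ∧ (u.1, x.2.1, u.2 + 1) ∈ L ∧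
    (x.1, Nat.pair x.2.1.unpair.1 (x.2.1.unpair.2 + 1), x.2.2) ∈ L)


theorem Just.mono (X : ℕ → Bool) (x : ℕ × ℕ × ℕ) (L M : List (ℕ × ℕ × ℕ)) (h : Just X x L)
    (hs : L ⊆ M) : Just X x M := by
  rcases h with h | h | h | h | h | ⟨u, h⟩ | ⟨u, h⟩ | ⟨u, h⟩ | ⟨u, h⟩ | ⟨u, h⟩ | ⟨u, h⟩
  · exact .inl h
  · exact .inr (.inl h)
  · exact .inr (.inr (.inl h))
  · exact .inr (.inr (.inr (.inl h)))
  · exact .inr (.inr (.inr (.inr (.inl h))))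
  · exact .inr (.inr (.inr (.inr (.inr (.inl ⟨u, h.1, hs h.2.1, hs h.2.2.1, h.2.2.2⟩)))))
  · exact .inr (.inr (.inr (.inr (.inr (.inr (.inl ⟨u, h.1, hs h.2.1, hs h.2.2⟩))))))
  · exact .inr (.inr (.inr (.inr (.inr (.inr (.inr (.inl ⟨u, h.1, h.2.1, hs h.2.2⟩)))))))
  · exact .inr (.inr (.inr (.inr (.inr (.inr (.inr (.inr (.inl
      ⟨u, h.1, h.2.1, hs h.2.2.1, hs h.2.2.2⟩))))))))
  · exact .inr (.inr (.inr (.inr (.inr (.inr (.inr (.inr (.inr (.inl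
      ⟨u, h.1, hs h.2.1, h.2.2⟩)))))))))
  · exact .inr (.inr (.inr (.inr (.inr (.inr (.inr (.inr (.inr (.inr
      ⟨u, h.1, hs h.2.1, hs h.2.2⟩)))))))))

theorem Just.sg : Sg Set.univ fun X (x : (ℕ × ℕ × ℕ) × List (ℕ × ℕ × ℕ)) => Just X x.1 x.2 := by
  unfold Just
  refine Sg.or (Sg.of_pred ?_) (Sg.or (Sg.of_pred ?_) (Sg.or (Sg.of_pred ?_) (Sg.or (Sg.of_pred ?_)
    (Sg.or (Sg.and (Sg.of_pred ?_) (Sg.ex (p := fun X (x : (ℕ × ℕ × ℕ) × List (ℕ × ℕ × ℕ)) b =>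
        X x.1.2.1 = b ∧ x.1.2.2 = cond b 1 0) (Sg.and
        (Sg.bit.comp (f := fun x : ((ℕ × ℕ × ℕ) × List (ℕ × ℕ × ℕ)) × Bool => (x.1.1.2.1, x.2))
          (by fun_prop)) (Sg.of_pred ?_))))
    (Sg.or (Sg.ex (Sg.of_pred ?_)) (Sg.or (Sg.ex (Sg.of_pred ?_)) (Sg.or (Sg.ex (Sg.of_pred ?_))
    (Sg.or (Sg.ex (Sg.of_pred ?_)) (Sg.or (Sg.ex (Sg.of_pred ?_)) (Sg.ex (Sg.of_pred ?_)))))))))))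
  all_goals repeat' apply PrimrecPred.and
  all_goals first
    | exact pp_eq (by fun_prop) (by fun_prop)
    | exact pp_mem (by fun_prop) (by fun_prop)

theorem encode_pair_inv (c : OracleCode) (a b : ℕ) (h : c.encodeCode = 4 * Nat.pair a b + 5) :
    ∃ f g, c = .pair f g ∧ f.encodeCode = a ∧ g.encodeCode = b := by
  cases c <;> simp only [OracleCode.encodeCode] at h <;> try omega
  have h2 := Nat.pair_eq_pair.1 (Nat.eq_of_mul_eq_mul_left (by norm_num) (Nat.add_right_cancel h))
  exact ⟨_, _, rfl, h2.1, h2.2⟩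

theorem encode_comp_inv (c : OracleCode) (a b : ℕ) (h : c.encodeCode = 4 * Nat.pair a b + 6) :
    ∃ f g, c = .comp f g ∧ f.encodeCode = a ∧ g.encodeCode = b := by
  cases c <;> simp only [OracleCode.encodeCode] at h <;> try omega
  have h2 := Nat.pair_eq_pair.1 (Nat.eq_of_mul_eq_mul_left (by norm_num) (Nat.add_right_cancel h))
  exact ⟨_, _, rfl, h2.1, h2.2⟩

theorem just_sound (X : ℕ → Bool) {x : ℕ × ℕ × ℕ} (h : Der (Just X) x) :
    ∀ c : OracleCode, c.encodeCode = x.1 → x.2.2 ∈ c.eval (chi X) x.2.1 := by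
  refine Der.induct (P := fun x : ℕ × ℕ × ℕ => ∀ c : OracleCode, c.encodeCode = x.1 →
    x.2.2 ∈ c.eval (chi X) x.2.1) ?_ h
  rintro ⟨e, n, v⟩ L hJ ih c rfl
  simp only at *
  rcases hJ with h | h | h | h | h | ⟨u, h⟩ | ⟨u, h⟩ | ⟨u, h⟩ | ⟨u, h⟩ | ⟨u, h⟩ | ⟨u, h⟩ <;>
    simp only at h
  · obtain rfl := encodeCode_inj c .zero h.1
    rw [h.2]; exact Part.mem_some _
  · obtain rfl := encodeCode_inj c .succ h.1
    rw [h.2]; exact Part.mem_some _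
  · obtain rfl := encodeCode_inj c .left h.1
    rw [h.2]; exact Part.mem_some _
  · obtain rfl := encodeCode_inj c .right h.1
    rw [h.2]; exact Part.mem_some _
  · obtain rfl := encodeCode_inj c .oracle h.1
    obtain ⟨-, b, rfl, h⟩ := h
    rw [h]; exact Part.mem_some _
  · obtain ⟨f, g, rfl, h1, h2⟩ := encode_pair_inv _ _ _ h.1
    exact (mem_eval_pair _ _ _ _ _).2 ⟨_, ih _ h.2.1 f h1, _, ih _ h.2.2.1 g h2, h.2.2.2⟩
  · obtain ⟨f, g, rfl, h1, h2⟩ := encode_comp_inv _ _ _ h.1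
    exact (mem_eval_comp _ _ _ _ _).2 ⟨_, ih _ h.2.1 g h2, ih _ h.2.2 f h1⟩
  · obtain ⟨f, g, rfl, h1, h2⟩ := encode_prec_inv _ _ _ h.1
    rw [h.2.1, eval_prec_zero]
    exact ih _ h.2.2 f h1
  · obtain ⟨f, g, rfl, h1, h2⟩ := encode_prec_inv _ _ _ h.1
    rw [h.2.1, mem_eval_prec_succ]
    exact ⟨_, ih _ h.2.2.1 _ rfl, ih _ h.2.2.2 g h2⟩
  · obtain ⟨f, rfl, h1⟩ := encode_rfind_inv _ _ h.1
    rw [← Nat.pair_unpair n, mem_eval_rfind]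
    exact ⟨0, by simpa using h.2.2, by simpa using ih _ h.2.1 f h1, by simp⟩
  · obtain ⟨f, rfl, h1⟩ := encode_rfind_inv _ _ h.1
    have h3 := ih _ h.2.2 _ rfl
    rw [mem_eval_rfind] at h3
    rw [← Nat.pair_unpair n, mem_eval_rfind]
    obtain ⟨k, hk, h4, h5⟩ := h3
    simp only at hk
    refine ⟨k + 1, by omega, ?_, ?_⟩
    · rw [show k + 1 + n.unpair.2 = k + (n.unpair.2 + 1) by omega]; exact h4
    · intro j hj
      cases j with
      | zero => exact ⟨u.2, by simpa using ih _ h.2.1 f h1⟩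
      | succ j =>
        rw [show j + 1 + n.unpair.2 = j + (n.unpair.2 + 1) by omega]
        exact h5 j (by omega)

theorem just_complete (X : ℕ → Bool) (c : OracleCode) :
    ∀ n v, v ∈ c.eval (chi X) n → Der (Just X) (c.encodeCode, n, v) := by
  have I := @Der.intro _ _ _ (Just.mono X)
  induction c with
  | zero =>
    intro n v h
    exact I [] (.inl ⟨rfl, Part.mem_some_iff.1 h⟩) (by simp)
  | succ =>
    intro n v h
    exact I [] (.inr (.inl ⟨rfl, Part.mem_some_iff.1 h⟩)) (by simp)
  | left =>
    intro n v h
    exact I [] (.inr (.inr (.inl ⟨rfl, Part.mem_some_iff.1 h⟩))) (by simp)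
  | right =>
    intro n v h
    exact I [] (.inr (.inr (.inr (.inl ⟨rfl, Part.mem_some_iff.1 h⟩)))) (by simp)
  | oracle =>
    intro n v h
    exact I [] (.inr (.inr (.inr (.inr (.inl ⟨rfl, _, rfl, Part.mem_some_iff.1 h⟩))))) (by simp)
  | pair f g ihf ihg =>
    intro n v h
    obtain ⟨a, ha, b, hb, rfl⟩ := (mem_eval_pair _ _ _ _ _).1 h
    refine I [(f.encodeCode, n, a), (g.encodeCode, n, b)]
      (.inr (.inr (.inr (.inr (.inr (.inl ⟨(f.encodeCode, g.encodeCode, a, b), rfl, by simp,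
        by simp, rfl⟩)))))) ?_
    intro y hy
    simp at hy
    rcases hy with rfl | rfl
    · exact ihf _ _ ha
    · exact ihg _ _ hb
  | comp f g ihf ihg =>
    intro n v h
    obtain ⟨a, ha, hb⟩ := (mem_eval_comp _ _ _ _ _).1 h
    refine I [(f.encodeCode, a, v), (g.encodeCode, n, a)]
      (.inr (.inr (.inr (.inr (.inr (.inr (.inl ⟨(f.encodeCode, g.encodeCode, a), rfl, by simp,
        by simp⟩))))))) ?_
    intro y hy
    simp at hy
    rcases hy with rfl | rfl
    · exact ihf _ _ hb
    · exact ihg _ _ ha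
  | prec f g ihf ihg =>
    intro n v h
    rw [← Nat.pair_unpair n] at h ⊢
    generalize n.unpair.1 = a at *
    generalize n.unpair.2 = m at *
    induction m generalizing v with
    | zero =>
      rw [eval_prec_zero] at h
      refine I [(f.encodeCode, a, v)]
        (.inr (.inr (.inr (.inr (.inr (.inr (.inr (.inl
          ⟨(f.encodeCode, g.encodeCode, a), rfl, rfl, by simp⟩)))))))) ?_
      intro y hy
      simp at hy
      subst hy
      exact ihf _ _ h
    | succ m ih =>
      rw [mem_eval_prec_succ] at h
      obtain ⟨i, hi, hv⟩ := h
      refine I [((OracleCode.prec f g).encodeCode, Nat.pair a m, i),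
          (g.encodeCode, Nat.pair a (Nat.pair m i), v)]
        (.inr (.inr (.inr (.inr (.inr (.inr (.inr (.inr (.inl
          ⟨(f.encodeCode, g.encodeCode, a, m, i), rfl, rfl, by simp, by simp⟩))))))))) ?_
      intro y hy
      simp at hy
      rcases hy with rfl | rfl
      · exact ih _ hi
      · exact ihg _ _ hv
  | rfind' f ihf =>
    intro n v h
    rw [← Nat.pair_unpair n] at h ⊢
    generalize n.unpair.1 = a at *
    generalize n.unpair.2 = m at *
    rw [mem_eval_rfind] at h
    obtain ⟨k, rfl, h0, h1⟩ := h
    induction k generalizing m with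
    | zero =>
      refine I [(f.encodeCode, Nat.pair a m, 0)]
        (.inr (.inr (.inr (.inr (.inr (.inr (.inr (.inr (.inr (.inl
          ⟨f.encodeCode, rfl, by simp, by simp⟩)))))))))) ?_
      intro y hy
      simp at hy
      subst hy
      exact ihf _ _ (by simpa using h0)
    | succ k ih =>
      obtain ⟨w, hw⟩ := h1 0 (by omega)
      refine I [(f.encodeCode, Nat.pair a m, w + 1),
          ((OracleCode.rfind' f).encodeCode, Nat.pair a (m + 1), k + 1 + m)]
        (.inr (.inr (.inr (.inr (.inr (.inr (.inr (.inr (.inr (.inr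
          ⟨(f.encodeCode, w), rfl, by simp, by simp⟩)))))))))) ?_
      intro y hy
      simp at hy
      rcases hy with rfl | rfl
      · exact ihf _ _ (by simpa using hw)
      · have := ih (m + 1) (by rwa [show k + (m + 1) = k + 1 + m by omega]) (by
          intro j hj
          have := h1 (j + 1) (by omega)
          rwa [show j + (m + 1) = j + 1 + m by omega])
        rwa [show k + (m + 1) = k + 1 + m by omega] at this

/-- Being the number of a code, by derivations. -/
def JustC (x : ℕ) (L : List ℕ) : Prop :=
  x < 5 ∨ (∃ u : ℕ × ℕ, x = 4 * Nat.pair u.1 u.2 + 5 ∧ u.1 ∈ L ∧ u.2 ∈ L) ∨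
  (∃ u : ℕ × ℕ, x = 4 * Nat.pair u.1 u.2 + 6 ∧ u.1 ∈ L ∧ u.2 ∈ L) ∨
  (∃ u : ℕ × ℕ, x = 4 * Nat.pair u.1 u.2 + 7 ∧ u.1 ∈ L ∧ u.2 ∈ L) ∨
  (∃ u : ℕ, x = 4 * Nat.pair u u + 8 ∧ u ∈ L)

theorem JustC.mono (x : ℕ) (L M : List ℕ) (h : JustC x L) (hs : L ⊆ M) : JustC x M := by
  rcases h with h | ⟨u, h⟩ | ⟨u, h⟩ | ⟨u, h⟩ | ⟨u, h⟩
  · exact .inl h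
  · exact .inr (.inl ⟨u, h.1, hs h.2.1, hs h.2.2⟩)
  · exact .inr (.inr (.inl ⟨u, h.1, hs h.2.1, hs h.2.2⟩))
  · exact .inr (.inr (.inr (.inl ⟨u, h.1, hs h.2.1, hs h.2.2⟩)))
  · exact .inr (.inr (.inr (.inr ⟨u, h.1, hs h.2⟩)))

theorem justC_iff (e : ℕ) : Der JustC e ↔ ∃ c : OracleCode, c.encodeCode = e := by
  have I := @Der.intro _ _ _ JustC.mono
  constructor
  · intro h
    refine Der.induct (P := fun e => ∃ c : OracleCode, c.encodeCode = e) ?_ h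
    rintro x L (h | ⟨u, h⟩ | ⟨u, h⟩ | ⟨u, h⟩ | ⟨u, h⟩) ih
    · interval_cases x
      · exact ⟨.zero, rfl⟩
      · exact ⟨.succ, rfl⟩
      · exact ⟨.left, rfl⟩
      · exact ⟨.right, rfl⟩
      · exact ⟨.oracle, rfl⟩
    · obtain ⟨c, hc⟩ := ih _ h.2.1
      obtain ⟨d, hd⟩ := ih _ h.2.2
      exact ⟨.pair c d, by simp [OracleCode.encodeCode, hc, hd, h.1]⟩
    · obtain ⟨c, hc⟩ := ih _ h.2.1
      obtain ⟨d, hd⟩ := ih _ h.2.2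
      exact ⟨.comp c d, by simp [OracleCode.encodeCode, hc, hd, h.1]⟩
    · obtain ⟨c, hc⟩ := ih _ h.2.1
      obtain ⟨d, hd⟩ := ih _ h.2.2
      exact ⟨.prec c d, by simp [OracleCode.encodeCode, hc, hd, h.1]⟩
    · obtain ⟨c, hc⟩ := ih _ h.2
      exact ⟨.rfind' c, by simp [OracleCode.encodeCode, hc, h.1]⟩
  · rintro ⟨c, rfl⟩
    induction c with
    | zero => exact I [] (.inl (by simp [OracleCode.encodeCode])) (by simp)
    | succ => exact I [] (.inl (by simp [OracleCode.encodeCode])) (by simp)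
    | left => exact I [] (.inl (by simp [OracleCode.encodeCode])) (by simp)
    | right => exact I [] (.inl (by simp [OracleCode.encodeCode])) (by simp)
    | oracle => exact I [] (.inl (by simp [OracleCode.encodeCode])) (by simp)
    | pair f g ihf ihg =>
      exact I [f.encodeCode, g.encodeCode]
        (.inr (.inl ⟨(f.encodeCode, g.encodeCode), rfl, by simp, by simp⟩)) (by simp [ihf, ihg])
    | comp f g ihf ihg =>
      exact I [f.encodeCode, g.encodeCode]
        (.inr (.inr (.inl ⟨(f.encodeCode, g.encodeCode), rfl, by simp, by simp⟩)))
        (by simp [ihf, ihg])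
    | prec f g ihf ihg =>
      exact I [f.encodeCode, g.encodeCode]
        (.inr (.inr (.inr (.inl ⟨(f.encodeCode, g.encodeCode), rfl, by simp, by simp⟩))))
        (by simp [ihf, ihg])
    | rfind' f ihf =>
      exact I [f.encodeCode] (.inr (.inr (.inr (.inr ⟨f.encodeCode, rfl, by simp⟩))))
        (by simp [ihf])

theorem JustC.sg {S : Set (ℕ → Bool)} : Sg S fun _ (x : ℕ × List ℕ) => JustC x.1 x.2 := by
  unfold JustC
  refine Sg.or (Sg.of_pred ?_) (Sg.or (Sg.ex (Sg.of_pred ?_)) (Sg.or (Sg.ex (Sg.of_pred ?_))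
    (Sg.or (Sg.ex (Sg.of_pred ?_)) (Sg.ex (Sg.of_pred ?_)))))
  all_goals repeat' apply PrimrecPred.and
  all_goals first
    | exact pp_eq (by fun_prop) (by fun_prop)
    | exact pp_lt (by fun_prop) (by fun_prop)
    | exact pp_mem (by fun_prop) (by fun_prop)

/-- The universal evaluation relation. -/
def Ev (X : ℕ → Bool) (e n v : ℕ) : Prop :=
  ∃ c : OracleCode, c.encodeCode = e ∧ v ∈ c.eval (chi X) n

theorem Ev.sg : Sg Set.univ (fun X (x : ℕ × ℕ × ℕ) => Ev X x.1 x.2.1 x.2.2) := by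
  have h1 : Sg Set.univ (fun X (x : ℕ × ℕ × ℕ) => Der (Just X) x) := Sg.der Just.sg
  have h2 : Sg Set.univ (fun _ (x : ℕ) => Der JustC x) := Sg.der JustC.sg
  refine (Sg.and (h2.comp (f := fun x : ℕ × ℕ × ℕ => x.1) (by fun_prop)) h1).congr ?_
  rintro X - ⟨e, n, v⟩
  simp only [justC_iff, Ev]
  constructor
  · rintro ⟨c, rfl, h⟩
    exact ⟨⟨c, rfl⟩, just_complete X c n v h⟩
  · rintro ⟨⟨c, rfl⟩, h⟩
    exact ⟨c, rfl, just_sound X h c rfl⟩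

end Part2

section Part3
/-! ## Codes for `Σ⁰₁` predicates -/

theorem exists_code_of_primrec {f : ℕ → ℕ} (hf : Nat.Primrec f) :
    ∃ c : OracleCode, ∀ g n, c.eval g n = Part.some (f n) := by
  induction hf with
  | zero => exact ⟨.zero, fun g n => rfl⟩
  | succ => exact ⟨.succ, fun g n => rfl⟩
  | left => exact ⟨.left, fun g n => rfl⟩
  | right => exact ⟨.right, fun g n => rfl⟩
  | pair _ _ ihf ihg =>
    obtain ⟨c, hc⟩ := ihf
    obtain ⟨d, hd⟩ := ihg
    refine ⟨.pair c d, fun g n => Part.eq_some_iff.2 ?_⟩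
    rw [mem_eval_pair]
    exact ⟨_, by rw [hc]; exact Part.mem_some _, _, by rw [hd]; exact Part.mem_some _, rfl⟩
  | comp _ _ ihf ihg =>
    obtain ⟨c, hc⟩ := ihf
    obtain ⟨d, hd⟩ := ihg
    refine ⟨.comp c d, fun g n => Part.eq_some_iff.2 ?_⟩
    rw [mem_eval_comp]
    exact ⟨_, by rw [hd]; exact Part.mem_some _, by rw [hc]; exact Part.mem_some _⟩
  | @prec f' g' _ _ ihf ihg =>
    obtain ⟨c, hc⟩ := ihf
    obtain ⟨d, hd⟩ := ihg
    refine ⟨.prec c d, fun g n => Part.eq_some_iff.2 ?_⟩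
    rw [← Nat.pair_unpair n]
    generalize n.unpair.1 = a
    generalize n.unpair.2 = m
    induction m with
    | zero => rw [eval_prec_zero, hc]; simp
    | succ m ih =>
      rw [mem_eval_prec_succ]
      exact ⟨_, ih, by rw [hd]; simp⟩

theorem exists_code_of_primrec' {f : ℕ → ℕ} (hf : Primrec f) :
    ∃ c : OracleCode, ∀ g n, c.eval g n = Part.some (f n) :=
  exists_code_of_primrec (Primrec.nat_iff.1 hf)

theorem pre_succ (X : ℕ → Bool) (k : ℕ) : pre X (k + 1) = pre X k ++ [X k] := by
  simp [pre, List.range_succ]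

@[fun_prop] theorem pr_append {α β : Type} [Primcodable α] [Primcodable β] {f g : α → List β}
    (hf : Primrec f) (hg : Primrec g) : Primrec (fun a => f a ++ g a) :=
  Primrec.list_append.comp hf hg

@[fun_prop] theorem pr_getD {α β : Type} [Primcodable α] [Primcodable β] {f : α → Option β}
    {g : α → β} (hf : Primrec f) (hg : Primrec g) : Primrec (fun a => (f a).getD (g a)) :=
  Primrec.option_getD.comp hf hg

@[fun_prop] theorem pr_decide {α : Type} [Primcodable α] {p : α → Prop} [DecidablePred p]
    (h : PrimrecPred p) : Primrec (fun a => decide (p a)) := by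
  obtain ⟨i, hi⟩ := h
  convert hi

theorem exists_code_pre : ∃ c : OracleCode, ∀ X k v,
    v ∈ c.eval (chi X) k ↔ v = Encodable.encode (pre X k) := by
  let h : ℕ → ℕ := fun u =>
    Encodable.encode (((Encodable.decode (α := List Bool) u.unpair.1).getD []) ++
      [decide (u.unpair.2 = 1)])
  have hh : Primrec h := by
    have : PrimrecPred (fun u : ℕ => u.unpair.2 = 1) := pp_eq (by fun_prop) (by fun_prop)
    fun_prop
  obtain ⟨ch, hch⟩ := exists_code_of_primrec' hh
  obtain ⟨c0, hc0⟩ := exists_code_of_primrec'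
    (Primrec.const (Encodable.encode ([] : List Bool)) : Primrec fun _ : ℕ => _)
  obtain ⟨ci, hci⟩ := exists_code_of_primrec'
    (f := fun u => u.unpair.2.unpair.2) (by fun_prop)
  obtain ⟨cy, hcy⟩ := exists_code_of_primrec'
    (f := fun u => u.unpair.2.unpair.1) (by fun_prop)
  obtain ⟨cp, hcp⟩ := exists_code_of_primrec'
    (f := fun u => Nat.pair 0 u) (by fun_prop)
  have key : ∀ X k v, v ∈ (OracleCode.prec c0 (.comp ch (.pair ci (.comp .oracle cy)))).eval
      (chi X) (Nat.pair 0 k) ↔ v = Encodable.encode (pre X k) := by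
    intro X k
    induction k with
    | zero => intro v; rw [eval_prec_zero, hc0, Part.mem_some_iff]; rfl
    | succ k ih =>
      intro v
      rw [mem_eval_prec_succ]
      simp only [ih, exists_eq_left, mem_eval_comp, mem_eval_pair, hci, hcy, hch, Part.mem_some_iff]
      have : ∀ a, a ∈ OracleCode.oracle.eval (chi X) k ↔ a = cond (X k) 1 0 :=
        fun a => Part.mem_some_iff
      simp only [Nat.unpair_pair, this, exists_eq_left, h, Encodable.encodek, Option.getD_some,
        pre_succ]
      cases X k <;> simp
  refine ⟨.comp (.prec c0 (.comp ch (.pair ci (.comp .oracle cy)))) cp, fun X k v => ?_⟩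
  rw [mem_eval_comp]
  simp only [hcp, Part.mem_some_iff, exists_eq_left, key]

/-- Unbounded search along the initial segments of the oracle. -/
theorem exists_code_search {R : ℕ × List Bool → Prop} (hR : PrimrecPred R)
    {out : ℕ × List Bool → ℕ} (ho : Primrec out) :
    ∃ c : OracleCode, ∀ X n v, v ∈ c.eval (chi X) n ↔
      ∃ k, R (n, pre X k) ∧ (∀ j < k, ¬ R (n, pre X j)) ∧ v = out (n, pre X k) := by
  classical
  obtain ⟨cpre, hpre⟩ := exists_code_pre
  let h : ℕ → ℕ := fun u => cond (decide (R (u.unpair.1,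
    ((Encodable.decode (α := List Bool) u.unpair.2).getD [])))) 0 1
  have hh : Primrec h := by
    have : PrimrecPred (fun u : ℕ => R (u.unpair.1,
      ((Encodable.decode (α := List Bool) u.unpair.2).getD []))) := hR.comp (by fun_prop)
    fun_prop
  obtain ⟨ch, hch⟩ := exists_code_of_primrec' hh
  obtain ⟨cp, hcp⟩ := exists_code_of_primrec'
    (f := fun u => Nat.pair u 0) (by fun_prop)
  obtain ⟨cid, hcid⟩ := exists_code_of_primrec' (f := fun u => u) (by fun_prop)
  obtain ⟨co, hco⟩ := exists_code_of_primrec'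
    (f := fun u => out (u.unpair.1, ((Encodable.decode (α := List Bool) u.unpair.2).getD [])))
    (by fun_prop)
  let cb : OracleCode := .comp ch (.pair .left (.comp cpre .right))
  have hcb : ∀ X n k v, v ∈ cb.eval (chi X) (Nat.pair n k) ↔
      v = cond (decide (R (n, pre X k))) 0 1 := by
    intro X n k v
    have h1 : ∀ g u a, a ∈ OracleCode.left.eval g u ↔ a = u.unpair.1 :=
      fun g u a => Part.mem_some_iff
    have h2 : ∀ g u a, a ∈ OracleCode.right.eval g u ↔ a = u.unpair.2 :=
      fun g u a => Part.mem_some_iff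
    simp only [cb, mem_eval_comp, mem_eval_pair, h1, h2, hpre, hch, Part.mem_some_iff,
      exists_eq_left, Nat.unpair_pair, h, Encodable.encodek, Option.getD_some]
  let cs : OracleCode := .comp (.rfind' cb) cp
  have hcs : ∀ X n k, k ∈ cs.eval (chi X) n ↔ R (n, pre X k) ∧ ∀ j < k, ¬ R (n, pre X j) := by
    intro X n k
    simp only [cs, mem_eval_comp, hcp, Part.mem_some_iff, exists_eq_left, mem_eval_rfind, hcb,
      Nat.add_zero]
    constructor
    · rintro ⟨k, rfl, h0, h1⟩
      refine ⟨?_, fun j hj hr => ?_⟩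
      · by_contra hr; simp [hr] at h0
      · obtain ⟨w, hw⟩ := h1 j hj
        simp [hr] at hw
    · rintro ⟨h0, h1⟩
      exact ⟨k, rfl, by simp [h0], fun j hj => ⟨0, by simp [h1 j hj]⟩⟩
  refine ⟨.comp co (.pair cid (.comp cpre cs)), fun X n v => ?_⟩
  simp only [mem_eval_comp, mem_eval_pair, hcid, hpre, hco, Part.mem_some_iff, exists_eq_left, hcs]
  constructor
  · rintro ⟨a, ⟨b, ⟨k, hk, rfl⟩, rfl⟩, hv⟩
    refine ⟨k, hk.1, hk.2, ?_⟩
    simpa using hv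
  · rintro ⟨k, h1, h2, rfl⟩
    exact ⟨_, ⟨_, ⟨k, ⟨h1, h2⟩, rfl⟩, rfl⟩, by simp⟩

theorem Sg.exists_code {S : Set (ℕ → Bool)} {p : (ℕ → Bool) → ℕ → Prop} (h : Sg S p) :
    ∃ c : OracleCode, ∀ X ∈ S, ∀ n, (c.eval (chi X) n).Dom ↔ p X n := by
  classical
  obtain ⟨R, hR, H⟩ := h
  obtain ⟨c, hc⟩ := exists_code_search hR (Primrec.const 0)
  refine ⟨c, fun X hX n => ?_⟩
  rw [H X hX n, Part.dom_iff_mem]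
  simp only [hc]
  constructor
  · rintro ⟨_, k, hk, -⟩
    exact ⟨k, hk⟩
  · intro hk
    exact ⟨0, Nat.find hk, Nat.find_spec hk, fun j hj => Nat.find_min hk hj, rfl⟩

theorem TRed.iff_sg {Z X : ℕ → Bool} :
    TRed Z X ↔ Sg {X} (fun _ (a : ℕ × Bool) => Z a.1 = a.2) := by
  classical
  constructor
  · rintro ⟨c, hc⟩
    refine ((Ev.sg.subset (S' := {X}) (by simp)).comp
      (f := fun a : ℕ × Bool => (c.encodeCode, a.1, cond a.2 1 0)) (by fun_prop)).congr ?_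
    rintro X' hX ⟨n, b⟩
    obtain rfl : X' = X := hX
    have : Ev X' c.encodeCode n (cond b 1 0) ↔ cond b 1 0 ∈ c.eval (chi X') n := by
      constructor
      · rintro ⟨d, hd, h⟩
        rwa [← encodeCode_inj _ _ hd]
      · exact fun h => ⟨c, rfl, h⟩
    refine Iff.trans ?_ this.symm
    rw [hc]
    refine Iff.trans ?_ Part.mem_some_iff.symm
    cases b <;> cases Z n <;> simp
  · intro h
    obtain ⟨R, hR, H, M⟩ := h.mono
    have h1 : PrimrecPred fun x : ℕ × List Bool => R ((x.1, true), x.2) := hR.comp (by fun_prop)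
    have h2 : PrimrecPred fun x : ℕ × List Bool => R ((x.1, false), x.2) := hR.comp (by fun_prop)
    obtain ⟨c, hc⟩ := exists_code_search (h1.or h2)
      (out := fun x => cond (decide (R ((x.1, true), x.2))) 1 0) (by fun_prop)
    refine ⟨c, funext fun n => Part.eq_some_iff.2 ?_⟩
    rw [hc]
    have hex : ∃ k, R ((n, true), pre X k) ∨ R ((n, false), pre X k) := by
      obtain ⟨k, hk⟩ := (H X rfl (n, Z n)).1 rfl
      refine ⟨k, ?_⟩
      cases hz : Z n <;> rw [hz] at hk <;> simp [hk]
    refine ⟨Nat.find hex, Nat.find_spec hex, fun j hj => Nat.find_min hex hj, ?_⟩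
    have h3 := Nat.find_spec hex
    have key : ∀ b, R ((n, b), pre X (Nat.find hex)) → Z n = b :=
      fun b hb => (H X rfl (n, b)).2 ⟨_, hb⟩
    by_cases h4 : R ((n, true), pre X (Nat.find hex))
    · simp [h4, key _ h4]
    · simp [h4, key _ (h3.resolve_left h4)]

theorem TRed.of_sg {Z X : ℕ → Bool} (h1 : Sg {X} fun _ n => Z n = true)
    (h2 : Sg {X} fun _ n => ¬ Z n = true) : TRed Z X := by
  rw [TRed.iff_sg]
  have e1 : Sg {X} (fun _ (a : ℕ × Bool) => Z a.1 = true ∧ a.2 = true) :=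
    (h1.comp (f := fun a : ℕ × Bool => a.1) (by fun_prop)).and
      (Sg.of_pred (pp_eq (by fun_prop) (by fun_prop)))
  have e2 : Sg {X} (fun _ (a : ℕ × Bool) => ¬ Z a.1 = true ∧ a.2 = false) :=
    (h2.comp (f := fun a : ℕ × Bool => a.1) (by fun_prop)).and
      (Sg.of_pred (pp_eq (by fun_prop) (by fun_prop)))
  refine (e1.or e2).congr ?_
  rintro _ - ⟨n, b⟩
  cases b <;> simp

/-! ## The jump -/

theorem jump_eq_true {X : ℕ → Bool} {n : ℕ} : jump X n = true ↔ ∃ v, Ev X n n v := by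
  simp only [jump, decide_eq_true_eq, Ev, Part.dom_iff_mem]
  constructor
  · rintro ⟨c, h, v, hv⟩
    exact ⟨v, c, h, hv⟩
  · rintro ⟨v, c, h, hv⟩
    exact ⟨c, h, v, hv⟩

theorem jump_sg : Sg Set.univ (fun X n => jump X n = true) := by
  have : Sg Set.univ (fun X n => ∃ v, Ev X n n v) :=
    Sg.ex (p := fun X n v => Ev X n n v)
      (Ev.sg.comp (f := fun x : ℕ × ℕ => (x.1, x.1, x.2)) (by fun_prop))
  exact this.congr fun X _ n => jump_eq_true

/-- Codes of constant functions. -/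
def constC : ℕ → OracleCode
  | 0 => .zero
  | n + 1 => .comp .succ (constC n)

theorem constC_eval (g : ℕ →. ℕ) (n m v : ℕ) : v ∈ (constC n).eval g m ↔ v = n := by
  induction n generalizing v with
  | zero => exact Part.mem_some_iff
  | succ n ih =>
    have : ∀ u a, a ∈ OracleCode.succ.eval g u ↔ a = u + 1 := fun u a => Part.mem_some_iff
    simp only [constC, mem_eval_comp, ih, exists_eq_left, this]

theorem constC_primrec : Primrec fun n => (constC n).encodeCode := by
  have : Primrec (fun n : ℕ => Nat.rec (motive := fun _ => ℕ) 0
      (fun _ i => 4 * Nat.pair 1 i + 6) n) := by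
    refine Primrec.nat_rec₁ 0 (f := fun _ i => 4 * Nat.pair 1 i + 6) ?_
    unfold Primrec₂
    fun_prop
  refine this.of_eq fun n => ?_
  induction n with
  | zero => rfl
  | succ n ih =>
    simp only [constC, OracleCode.encodeCode]
    rw [← ih]

/-- Every `Σ⁰₁(X)` predicate is many-one reducible to the jump. -/
theorem Sg.to_jump {S : Set (ℕ → Bool)} {α : Type} [Primcodable α] {p : (ℕ → Bool) → α → Prop}
    (h : Sg S p) : ∃ f : α → ℕ, Primrec f ∧ ∀ X ∈ S, ∀ a, p X a ↔ jump X (f a) = true := by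
  have h1 : Sg S (fun X (n : ℕ) => ∃ a : α, n = Encodable.encode a ∧ p X a) :=
    Sg.ex (p := fun X (n : ℕ) (a : α) => n = Encodable.encode a ∧ p X a)
      ((Sg.of_pred (pp_eq (by fun_prop) (by fun_prop))).and
        (h.comp (f := fun x : ℕ × α => x.2) (by fun_prop)))
  obtain ⟨c, hc⟩ := h1.exists_code
  refine ⟨fun a => 4 * Nat.pair c.encodeCode (constC (Encodable.encode a)).encodeCode + 6, ?_, ?_⟩
  · have h2 := constC_primrec
    have h3 : Primrec fun a : α => (constC (Encodable.encode a)).encodeCode :=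
      h2.comp Primrec.encode
    fun_prop
  · intro X hX a
    have e : (4 * Nat.pair c.encodeCode (constC (Encodable.encode a)).encodeCode + 6) =
      (OracleCode.comp c (constC (Encodable.encode a))).encodeCode := rfl
    beta_reduce
    rw [e, jump_eq_true]
    have : p X a ↔ (c.eval (chi X) (Encodable.encode a)).Dom := by
      rw [hc X hX]
      constructor
      · exact fun h => ⟨a, rfl, h⟩
      · rintro ⟨b, hb, h⟩
        rwa [Encodable.encode_injective hb]
    rw [this, Part.dom_iff_mem]
    refine exists_congr fun v => ?_
    constructor
    · intro hv
      exact ⟨_, rfl, (mem_eval_comp _ _ _ _ _).2 ⟨_, (constC_eval _ _ _ _).2 rfl, hv⟩⟩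
    · rintro ⟨d, hd, hv⟩
      obtain rfl := encodeCode_inj _ _ hd
      obtain ⟨u, hu, hv⟩ := (mem_eval_comp _ _ _ _ _).1 hv
      rw [constC_eval] at hu
      rwa [← hu]

theorem Sg.jump_pos {X : ℕ → Bool} {α : Type} [Primcodable α] {p : α → Prop}
    (h : Sg {X} fun _ a => p a) : Sg {jump X} fun _ a => p a := by
  obtain ⟨f, hf, H⟩ := h.to_jump
  refine (Sg.bit.comp (f := fun a => (f a, true)) (by fun_prop)).congr ?_
  rintro _ rfl a
  exact H X rfl a

theorem Sg.jump_neg {X : ℕ → Bool} {α : Type} [Primcodable α] {p : α → Prop}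
    (h : Sg {X} fun _ a => p a) : Sg {jump X} fun _ a => ¬ p a := by
  obtain ⟨f, hf, H⟩ := h.to_jump
  refine (Sg.bit.comp (f := fun a => (f a, false)) (by fun_prop)).congr ?_
  rintro _ rfl a
  have := H X rfl a
  simp [this]

theorem jump_diag (X : ℕ → Bool) : ¬ Sg {X} (fun _ n => ¬ jump X n = true) := by
  intro h
  obtain ⟨c, hc⟩ := h.exists_code
  have h1 := hc X rfl c.encodeCode
  rw [jump_eq_true, Part.dom_iff_mem] at h1
  have h2 : (∃ v, Ev X c.encodeCode c.encodeCode v) ↔ ∃ y, y ∈ c.eval (chi X) c.encodeCode := by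
    refine exists_congr fun v => ?_
    constructor
    · rintro ⟨d, hd, hv⟩
      rwa [encodeCode_inj _ _ hd] at hv
    · exact fun hv => ⟨c, rfl, hv⟩
  tauto

theorem Sg.mono_jump {X Y : ℕ → Bool} (h : TRed X Y) : TRed (jump X) (jump Y) := by
  have h1 : Sg {Y} (fun _ n => jump X n = true) :=
    (TRed.iff_sg.1 h).trans ((jump_sg.subset (S' := {X}) (by simp)).congr (by rintro _ rfl a; rfl))
  exact TRed.of_sg h1.jump_pos h1.jump_neg

end Part3

section Part4
/-! ## Topology of Cantor space -/

theorem isClopen_pre (Q : List Bool → Prop) (k : ℕ) : IsClopen {X : ℕ → Bool | Q (pre X k)} := by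
  have h : Continuous (fun (X : ℕ → Bool) (i : Fin k) => X i.1) := by fun_prop
  have : {X : ℕ → Bool | Q (pre X k)} =
      (fun (X : ℕ → Bool) (i : Fin k) => X i.1) ⁻¹' {f | Q (List.ofFn f)} := by
    ext X
    simp [pre_ofFn]
  rw [this]
  exact (isClopen_discrete _).preimage h

theorem Sg.isOpen {α : Type} [Primcodable α] {p : (ℕ → Bool) → α → Prop} (h : Sg Set.univ p)
    (a : α) : IsOpen {X | p X a} := by
  obtain ⟨R, hR, H⟩ := h
  have : {X | p X a} = ⋃ k, {X | R (a, pre X k)} := by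
    ext X
    simp [H X trivial a]
  rw [this]
  exact isOpen_iUnion fun k => (isClopen_pre (fun σ => R (a, σ)) k).2

/-- All strings of length `k`. -/
def strs : ℕ → List (List Bool)
  | 0 => [[]]
  | k + 1 => (strs k).map (fun σ => σ ++ [false]) ++ (strs k).map (fun σ => σ ++ [true])

theorem mem_strs {k : ℕ} {σ : List Bool} : σ ∈ strs k ↔ σ.length = k := by
  induction k generalizing σ with
  | zero => simp [strs]
  | succ k ih =>
    simp only [strs, List.mem_append, List.mem_map, ih]
    constructor
    · rintro (⟨τ, h, rfl⟩ | ⟨τ, h, rfl⟩) <;> simp [h]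
    · intro h
      have hne : σ ≠ [] := by rintro rfl; simp at h
      have h2 := List.dropLast_append_getLast hne
      cases hb : σ.getLast hne
      · exact .inl ⟨σ.dropLast, by simp [h], by rw [← hb]; exact h2⟩
      · exact .inr ⟨σ.dropLast, by simp [h], by rw [← hb]; exact h2⟩

theorem strs_primrec : Primrec strs := by
  have h : Primrec₂ (fun (_ : ℕ) (l : List (List Bool)) =>
      l.map (fun σ => σ ++ [false]) ++ l.map (fun σ => σ ++ [true])) := by
    refine Primrec.list_append.comp (Primrec.list_map Primrec.snd ?_)
      (Primrec.list_map Primrec.snd ?_) <;> (unfold Primrec₂; fun_prop)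
  refine (Primrec.nat_rec₁ [[]] h).of_eq fun n => ?_
  induction n with
  | zero => rfl
  | succ n ih => simp only [strs]; rw [← ih]

@[fun_prop] theorem pr_strs {α : Type} [Primcodable α] {f : α → ℕ} (hf : Primrec f) :
    Primrec (fun a => strs (f a)) := strs_primrec.comp hf

/-- Extend a string by zeros. -/
def ext0 (σ : List Bool) : ℕ → Bool := fun i => (σ[i]?).getD false

theorem pre_ext0 (σ : List Bool) : pre (ext0 σ) σ.length = σ := by
  rw [pre_eq_iff]
  intro i hi
  simp [ext0, hi]

/-- Compactness: a decreasing sequence of nonempty clopen sets. -/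
theorem exists_bound {Q : List Bool → Prop} (hm : ∀ X j k, j ≤ k → Q (pre X j) → Q (pre X k))
    (h : ∀ X, ∃ k, Q (pre X k)) : ∃ k, ∀ X, Q (pre X k) := by
  by_contra hcon
  push Not at hcon
  have := IsCompact.nonempty_iInter_of_sequence_nonempty_isCompact_isClosed
    (fun k => {X : ℕ → Bool | ¬ Q (pre X k)})
    (fun k X hX hq => hX (hm X k (k + 1) (by omega) hq)) hcon
    (isClopen_pre (fun σ => ¬ Q σ) 0).1.isCompact
    (fun k => (isClopen_pre (fun σ => ¬ Q σ) k).1)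
  obtain ⟨X, hX⟩ := this
  obtain ⟨k, hk⟩ := h X
  exact Set.mem_iInter.1 hX k hk

theorem Sg.all_oracle {S : Set (ℕ → Bool)} {α : Type} [Primcodable α]
    {p : (ℕ → Bool) → α → Prop} (h : Sg Set.univ p) : Sg S (fun _ a => ∀ X, p X a) := by
  obtain ⟨R, hR, H, M⟩ := h.mono
  have h1 : PrimrecPred fun x : α × ℕ => ∀ σ ∈ strs x.2, R (x.1, σ) :=
    pp_ball (p := fun (x : α × ℕ) σ => R (x.1, σ)) (hR.comp (by fun_prop)) (by fun_prop)
  refine (Sg.ex (p := fun _ (a : α) (k : ℕ) => ∀ σ ∈ strs k, R (a, σ)) (Sg.of_pred h1)).congr ?_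
  intro _ _ a
  constructor
  · intro h
    obtain ⟨k, hk⟩ := exists_bound (Q := fun σ => R (a, σ)) (fun X => M X a)
      (fun X => (H X trivial a).1 (h X))
    refine ⟨k, fun σ hσ => ?_⟩
    rw [mem_strs] at hσ
    subst hσ
    have := hk (ext0 σ)
    rwa [pre_ext0] at this
  · rintro ⟨k, hk⟩ X
    exact (H X trivial a).2 ⟨k, hk _ (mem_strs.2 (by simp))⟩

/-! ## `Π⁰₁` classes -/

/-- The `Π⁰₁` class with index `p`. -/
def Cl (p : ℕ) : Set (ℕ → Bool) := {X | ¬ ∃ v, Ev X p.unpair.1 p.unpair.2 v}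

theorem Cl.sg : Sg Set.univ (fun X p => X ∉ Cl p) := by
  refine (Sg.ex (p := fun X (p : ℕ) v => Ev X p.unpair.1 p.unpair.2 v)
    (Ev.sg.comp (f := fun x : ℕ × ℕ => (x.1.unpair.1, x.1.unpair.2, x.2)) (by fun_prop))).congr ?_
  intro X _ p
  simp [Cl]

theorem Cl.isClosed (p : ℕ) : IsClosed (Cl p) := ⟨Cl.sg.isOpen p⟩

theorem Cl.index {α : Type} [Primcodable α] {q : (ℕ → Bool) → α → Prop} (h : Sg Set.univ q) :
    ∃ f : α → ℕ, Primrec f ∧ ∀ X a, X ∈ Cl (f a) ↔ ¬ q X a := by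
  have h1 : Sg Set.univ (fun X (n : ℕ) => ∃ a : α, n = Encodable.encode a ∧ q X a) :=
    Sg.ex (p := fun X (n : ℕ) (a : α) => n = Encodable.encode a ∧ q X a)
      ((Sg.of_pred (pp_eq (by fun_prop) (by fun_prop))).and
        (h.comp (f := fun x : ℕ × α => x.2) (by fun_prop)))
  obtain ⟨c, hc⟩ := h1.exists_code
  refine ⟨fun a => Nat.pair c.encodeCode (Encodable.encode a), by fun_prop, fun X a => ?_⟩
  have h2 := hc X trivial (Encodable.encode a)
  simp only [Cl, Set.mem_ofPred_eq, Nat.unpair_pair]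
  refine not_congr ?_
  have h3 : (∃ v, Ev X c.encodeCode (Encodable.encode a) v) ↔
      (c.eval (chi X) (Encodable.encode a)).Dom := by
    rw [Part.dom_iff_mem]
    refine exists_congr fun v => ?_
    constructor
    · rintro ⟨d, hd, hv⟩
      rwa [encodeCode_inj _ _ hd] at hv
    · exact fun hv => ⟨c, rfl, hv⟩
  rw [h3, h2]
  constructor
  · rintro ⟨b, hb, h⟩
    rwa [Encodable.encode_injective hb]
  · exact fun h => ⟨a, rfl, h⟩

/-- Not extending a string is uniformly open. -/
theorem Sg.not_ext {S : Set (ℕ → Bool)} :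
    Sg S (fun X (σ : List Bool) => ¬ pre X σ.length = σ) := by
  refine ⟨fun x => x.1.length ≤ x.2.length ∧ ¬ x.2.take x.1.length = x.1, ?_, ?_⟩
  · exact (pp_le (by fun_prop) (by fun_prop)).and (pp_eq (by fun_prop) (by fun_prop)).not
  · intro X _ σ
    constructor
    · intro h
      exact ⟨σ.length, by simp, by simpa [pre_take X le_rfl] using h⟩
    · rintro ⟨k, h1, h2⟩
      simp only [pre_length] at h1
      rwa [pre_take X h1] at h2

theorem Sg.of_pre {S : Set (ℕ → Bool)} {α : Type} [Primcodable α] {Q : α × List Bool → Prop}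
    (hQ : PrimrecPred Q) {f : α → ℕ} (hf : Primrec f) : Sg S (fun X a => Q (a, pre X (f a))) := by
  refine ⟨fun x => f x.1 ≤ x.2.length ∧ Q (x.1, x.2.take (f x.1)), ?_, ?_⟩
  · exact (pp_le (by fun_prop) (by fun_prop)).and (hQ.comp (by fun_prop))
  · intro X _ a
    constructor
    · intro h
      exact ⟨f a, by simp, by simpa [pre_take X le_rfl] using h⟩
    · rintro ⟨k, h1, h2⟩
      simp only [pre_length] at h1
      rwa [pre_take X h1] at h2

/-- Uniformization. -/
theorem Sg.unif {X : ℕ → Bool} {α : Type} [Primcodable α] {D : α → ℕ → Prop}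
    (h : Sg {X} fun _ (x : α × ℕ) => D x.1 x.2) :
    ∃ G : α → ℕ → Prop, Sg {X} (fun _ (x : α × ℕ) => G x.1 x.2) ∧ (∀ a w, G a w → D a w) ∧
      (∀ a, (∃ w, D a w) → ∃ w, G a w) ∧ ∀ a w w', G a w → G a w' → w = w' := by
  classical
  obtain ⟨R, hR, H⟩ := h
  have hP : PrimrecPred (fun y : (α × ℕ) × List Bool => R ((y.1.1, y.1.2.unpair.1), y.2)) :=
    hR.comp (by fun_prop)
  have h1 : Sg {X} fun X' (x : α × ℕ) => R ((x.1, x.2.unpair.1), pre X' x.2.unpair.2) :=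
    Sg.of_pre hP (f := fun x : α × ℕ => x.2.unpair.2) (by fun_prop)
  have h2 : Sg {X} fun X' (x : α × ℕ) => ¬ R ((x.1, x.2.unpair.1), pre X' x.2.unpair.2) :=
    Sg.of_pre hP.not (f := fun x : α × ℕ => x.2.unpair.2) (by fun_prop)
  let Q : α → ℕ → Prop := fun a N => R ((a, N.unpair.1), pre X N.unpair.2)
  have h1' : Sg {X} fun _ (x : α × ℕ) => Q x.1 x.2 := h1.congr (by rintro _ rfl a; rfl)
  have h2' : Sg {X} fun _ (x : α × ℕ) => ¬ Q x.1 x.2 := h2.congr (by rintro _ rfl a; rfl)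
  refine ⟨fun a w => ∃ N, N.unpair.1 = w ∧ Q a N ∧ ∀ M < N, ¬ Q a M, ?_, ?_, ?_, ?_⟩
  · refine Sg.ex (p := fun _ (x : α × ℕ) N => N.unpair.1 = x.2 ∧ Q x.1 N ∧ ∀ M < N, ¬ Q x.1 M) ?_
    refine (Sg.of_pred (pp_eq (by fun_prop) (by fun_prop))).and (Sg.and ?_ ?_)
    · exact h1'.comp (f := fun x : (α × ℕ) × ℕ => (x.1.1, x.2)) (by fun_prop)
    · refine Sg.all_lt (p := fun _ (x : (α × ℕ) × ℕ) M => ¬ Q x.1.1 M) ?_ (by fun_prop)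
      exact h2'.comp (f := fun x : ((α × ℕ) × ℕ) × ℕ => (x.1.1.1, x.2)) (by fun_prop)
  · rintro a w ⟨N, rfl, hN, -⟩
    exact (H X rfl (a, _)).2 ⟨_, hN⟩
  · rintro a ⟨w, hw⟩
    obtain ⟨k, hk⟩ := (H X rfl (a, w)).1 hw
    have hex : ∃ N, Q a N := ⟨Nat.pair w k, by simpa [Q] using hk⟩
    exact ⟨_, Nat.find hex, rfl, Nat.find_spec hex, fun M hM => Nat.find_min hex hM⟩
  · rintro a _ _ ⟨N, rfl, hN, hN'⟩ ⟨M, rfl, hM, hM'⟩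
    rcases lt_trichotomy N M with h | h | h
    · exact absurd hN (hM' _ h)
    · rw [h]
    · exact absurd hM (hN' _ h)

/-- Definitions by recursion. -/
theorem Sg.rec_graph {Y : ℕ → Bool} {g : ℕ → ℕ} {Gr : ℕ → ℕ → ℕ → Prop}
    (h : Sg {Y} fun _ (x : ℕ × ℕ × ℕ) => Gr x.1 x.2.1 x.2.2)
    (hg : ∀ s v, Gr s (g s) v ↔ v = g (s + 1)) :
    Sg {Y} (fun _ (x : ℕ × ℕ) => g x.1 = x.2) := by
  let J : ℕ × ℕ → List (ℕ × ℕ) → Prop := fun x L =>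
    (x.1 = 0 ∧ x.2 = g 0) ∨ ∃ u : ℕ × ℕ, x.1 = u.1 + 1 ∧ u ∈ L ∧ Gr u.1 u.2 x.2
  have hm : ∀ x L M, J x L → L ⊆ M → J x M := by
    rintro x L M (h | ⟨u, h1, h2, h3⟩) hs
    · exact .inl h
    · exact .inr ⟨u, h1, hs h2, h3⟩
  have hJ : Sg {Y} (fun _ (x : (ℕ × ℕ) × List (ℕ × ℕ)) => J x.1 x.2) := by
    refine Sg.or (Sg.of_pred ((pp_eq (by fun_prop) (by fun_prop)).and
      (pp_eq (by fun_prop) (by fun_prop)))) ?_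
    refine Sg.ex (p := fun _ (x : (ℕ × ℕ) × List (ℕ × ℕ)) (u : ℕ × ℕ) =>
      x.1.1 = u.1 + 1 ∧ u ∈ x.2 ∧ Gr u.1 u.2 x.1.2) ?_
    refine (Sg.of_pred (pp_eq (by fun_prop) (by fun_prop))).and
      ((Sg.of_pred (pp_mem (by fun_prop) (by fun_prop))).and ?_)
    exact h.comp (f := fun x : ((ℕ × ℕ) × List (ℕ × ℕ)) × (ℕ × ℕ) => (x.2.1, x.2.2, x.1.1.2))
      (by fun_prop)
  refine (Sg.der (J := fun _ => J) hJ).congr ?_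
  rintro _ - ⟨s, v⟩
  constructor
  · intro hv
    obtain rfl : g s = v := hv
    induction s with
    | zero => exact Der.intro hm [] (.inl ⟨rfl, rfl⟩) (by simp)
    | succ s ih =>
      exact Der.intro hm [(s, g s)] (.inr ⟨(s, g s), rfl, by simp, (hg _ _).2 rfl⟩) (by simpa using ih)
  · intro h
    refine Der.induct (P := fun x : ℕ × ℕ => g x.1 = x.2) ?_ h
    rintro ⟨s, v⟩ L (⟨h1, h2⟩ | ⟨u, h1, h2, h3⟩) ih
    · simp only at h1 h2 ⊢; rw [h1, h2]
    · simp only at h1 h3 ⊢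
      rw [← ih u h2, hg] at h3
      rw [h1, h3]

end Part4

section Part5
/-! ## Fair-coin measure -/

open MeasureTheory

/-- The fair coin. -/
noncomputable def coin : Measure Bool := (2 : ℝ≥0∞)⁻¹ • Measure.count

instance : IsProbabilityMeasure coin := ⟨by
  have h : (Measure.count (Set.univ : Set Bool) : ℝ≥0∞) = 2 := by
    rw [Measure.count_univ]; simp
  rw [coin, Measure.smul_apply, h, smul_eq_mul]
  exact ENNReal.inv_mul_cancel (by norm_num) (by norm_num)⟩

theorem coin_singleton (b : Bool) : coin {b} = (2 : ℝ≥0∞)⁻¹ := by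
  simp [coin]

/-- The fair-coin measure. -/
noncomputable def mu : Measure (ℕ → Bool) := Measure.infinitePi fun _ => coin

instance : IsProbabilityMeasure mu := by unfold mu; infer_instance

theorem measurable_pre (Q : List Bool → Prop) (k : ℕ) :
    MeasurableSet {X : ℕ → Bool | Q (pre X k)} :=
  (isClopen_pre Q k).1.measurableSet

theorem mu_restr (m : ℕ) (f : Fin m → Bool) :
    mu {X | (fun i : Fin m => X i.1) = f} = (2 : ℝ≥0∞)⁻¹ ^ m := by
  have h : {X : ℕ → Bool | (fun i : Fin m => X i.1) = f} =
      Set.pi (Finset.range m : Set ℕ) (fun i => {ext0 (List.ofFn f) i}) := by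
    ext X
    simp only [Set.mem_ofPred_eq, Set.mem_pi, Finset.coe_range, Set.mem_Iio, Set.mem_singleton_iff,
      ext0, funext_iff]
    constructor
    · intro h i hi
      simp [hi, ← h ⟨i, hi⟩]
    · intro h i
      simp [h i.1 i.2]
  rw [h, mu, Measure.infinitePi_pi _ (by simp)]
  simp [coin_singleton]

theorem mu_card (m : ℕ) (F : (Fin m → Bool) → Prop) :
    mu {X | F (fun i : Fin m => X i.1)} = (Nat.card {f // F f} : ℝ≥0∞) / 2 ^ m := by
  classical
  have h : {X : ℕ → Bool | F (fun i : Fin m => X i.1)} =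
      ⋃ f ∈ Finset.univ.filter F, {X | (fun i : Fin m => X i.1) = f} := by
    ext X
    simp
  rw [h, measure_biUnion_finset]
  · simp only [mu_restr, Finset.sum_const, nsmul_eq_mul]
    rw [Nat.card_eq_fintype_card, Fintype.card_subtype, ← ENNReal.inv_pow, div_eq_mul_inv]
  · intro f _ g _ hfg
    refine Set.disjoint_left.2 ?_
    intro X h1 h2
    exact hfg (h1.symm.trans h2)
  · intro f _
    have h2 : {X : ℕ → Bool | (fun i : Fin m => X i.1) = f} = {X | pre X m = List.ofFn f} := by
      ext X
      simp only [Set.mem_ofPred_eq, ← pre_ofFn]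
      exact ⟨fun h => by rw [← h], fun h => List.ofFn_injective h⟩
    rw [h2]
    exact measurable_pre (fun σ => σ = List.ofFn f) m

theorem mu_pre (σ : List Bool) : mu {X | pre X σ.length = σ} = (2 : ℝ≥0∞)⁻¹ ^ σ.length := by
  rw [← mu_restr σ.length (fun i => σ.get i)]
  congr 1
  ext X
  simp only [Set.mem_ofPred_eq, ← extendsStr_iff, extendsStr, funext_iff]

theorem mu_paths_pos (T : List Bool → Bool) (htree : IsTree T)
    (hpos : 0 < cantorMeasure (pathsOf T)) : 0 < mu (pathsOf T) := by
  have h1 : pathsOf T = ⋂ n, {X | T (pre X n) = true} := by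
    ext X
    simp [pathsOf, pre_ofFn]
  have hanti : Antitone fun n => {X | T (pre X n) = true} := by
    intro m n hmn X hX
    refine htree _ _ ?_ hX
    rw [← pre_take X hmn]
    exact List.take_prefix _ _
  rw [h1, hanti.measure_iInter (fun n => (measurable_pre (fun σ => T σ = true) n).nullMeasurableSet)
    ⟨0, measure_ne_top _ _⟩]
  refine lt_of_lt_of_le hpos (le_iInf fun n => ?_)
  refine (iInf₂_le {σ | σ.length = n ∧ T σ = true} ?_).trans ?_
  · intro X hX
    refine ⟨pre X n, ⟨by simp, ?_⟩, ?_⟩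
    · have := hX n
      rwa [pre_ofFn] at this
    · rw [extendsStr_iff]; simp
  · refine iSup_le fun m => ?_
    rw [← mu_card m (fun f => ∃ σ ∈ {σ : List Bool | σ.length = n ∧ T σ = true}, σ <+: List.ofFn f)]
    refine measure_mono ?_
    rintro X ⟨σ, ⟨hσ, hT⟩, hp⟩
    rw [pre_ofFn] at hp
    have hl : n ≤ m := by simpa [hσ] using hp.length_le
    have : σ = pre X n := by
      rw [List.prefix_iff_eq_take, hσ, pre_take X hl] at hp
      exact hp
    rw [Set.mem_ofPred_eq, ← this]
    exact hT

/-- A measure-theoretic choice principle. -/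
theorem exists_avoid (S : Set (ℕ → Bool)) (B : ℕ → Set (ℕ → Bool)) (k : ℕ)
    (hS : (2 : ℝ≥0∞)⁻¹ ^ k < mu S) (hB : ∀ i, mu (B i) ≤ (2 : ℝ≥0∞)⁻¹ ^ (i + (k + 1))) :
    ∃ X ∈ S, ∀ i, X ∉ B i := by
  by_contra hcon
  push Not at hcon
  have h1 : S ⊆ ⋃ i, B i := by
    intro X hX
    simpa using hcon X hX
  have h2 : mu S ≤ (2 : ℝ≥0∞)⁻¹ ^ k := by
    calc mu S ≤ mu (⋃ i, B i) := measure_mono h1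
      _ ≤ ∑' i, mu (B i) := measure_iUnion_le _
      _ ≤ ∑' i, (2 : ℝ≥0∞)⁻¹ ^ (i + (k + 1)) := ENNReal.tsum_le_tsum hB
      _ = (∑' i, (2 : ℝ≥0∞)⁻¹ ^ i) * (2 : ℝ≥0∞)⁻¹ ^ (k + 1) := by
        rw [← ENNReal.tsum_mul_right]; simp only [pow_add]
      _ = (2 : ℝ≥0∞)⁻¹ ^ k := by
        rw [ENNReal.tsum_geometric, ENNReal.one_sub_inv_two, inv_inv, pow_succ', ← mul_assoc,
          ENNReal.mul_inv_cancel (by norm_num) (by norm_num), one_mul]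
  exact absurd hS (not_lt.2 h2)

theorem exists_pow_lt {x : ℝ≥0∞} (hx : 0 < x) : ∃ c : ℕ, (2 : ℝ≥0∞)⁻¹ ^ c < x := by
  have h := ENNReal.tendsto_pow_atTop_nhds_zero_of_lt_one
    (r := (2 : ℝ≥0∞)⁻¹) (by simp)
  exact ((tendsto_order.1 h).2 x hx).exists

/-! ## The base class -/

/-- The cylinder of `σ`. -/
def cyl (σ : List Bool) : Set (ℕ → Bool) := {X | pre X σ.length = σ}

theorem exists_base (P : Set (ℕ → Bool)) (hP : Sg Set.univ fun X (_ : ℕ) => X ∉ P)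
    (hpos : 0 < mu P) : ∃ p0 c : ℕ, Cl p0 ⊆ P ∧ (Cl p0).Nonempty ∧
      ∀ q, Cl q ⊆ Cl p0 → (Cl q).Nonempty → (2 : ℝ≥0∞)⁻¹ ^ (q + c) ≤ mu (Cl q) := by
  classical
  obtain ⟨R, hR, H, M⟩ := Cl.sg.mono
  obtain ⟨k, hk⟩ := exists_pow_lt hpos
  let small : ℕ → ℕ → List (List Bool) → Prop := fun q n L =>
    (∀ σ ∈ strs n, R (q, σ) ∨ σ ∈ L) ∧ L.length * 2 ^ (q + (k + 1)) < 2 ^ n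
  have hsmall : PrimrecPred (fun x : ℕ × ℕ × List (List Bool) => small x.1 x.2.1 x.2.2) := by
    refine PrimrecPred.and (pp_ball (p := fun (x : ℕ × ℕ × List (List Bool)) σ =>
      R (x.1, σ) ∨ σ ∈ x.2.2) ?_ (by fun_prop)) (pp_lt (by fun_prop) (by fun_prop))
    exact PrimrecPred.or (hR.comp (by fun_prop)) (pp_mem (by fun_prop) (by fun_prop))
  have hsg : Sg Set.univ (fun X (_ : ℕ) => X ∉ P ∨ ∃ x : ℕ × ℕ × List (List Bool),
      small x.1 x.2.1 x.2.2 ∧ ¬ R (x.1, pre X x.2.1)) := by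
    refine hP.or (Sg.ex (p := fun X (_ : ℕ) (x : ℕ × ℕ × List (List Bool)) =>
      small x.1 x.2.1 x.2.2 ∧ ¬ R (x.1, pre X x.2.1)) ?_)
    refine Sg.and (Sg.of_pred (hsmall.comp (by fun_prop))) ?_
    exact Sg.of_pre (Q := fun y : (ℕ × ℕ × ℕ × List (List Bool)) × List Bool =>
      ¬ R (y.1.2.1, y.2)) (hR.comp (by fun_prop)).not
      (f := fun x : ℕ × ℕ × ℕ × List (List Bool) => x.2.2.1) (by fun_prop)
  obtain ⟨f, hf, hidx⟩ := Cl.index hsg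
  have hLev : ∀ q n L, small q n L →
      mu {X | ¬ R (q, pre X n)} ≤ (2 : ℝ≥0∞)⁻¹ ^ (q + (k + 1)) := by
    rintro q n L ⟨h1, h2⟩
    have hs : {X : ℕ → Bool | ¬ R (q, pre X n)} ⊆
        ⋃ σ ∈ (L.toFinset.filter fun σ => σ.length = n), {X | pre X σ.length = σ} := by
      intro X hX
      have := (h1 (pre X n) (mem_strs.2 (by simp))).resolve_left hX
      simp only [Set.mem_iUnion]
      exact ⟨pre X n, by simp [this], by simp⟩
    calc mu {X | ¬ R (q, pre X n)} ≤ _ := measure_mono hs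
      _ ≤ ∑ σ ∈ (L.toFinset.filter fun σ => σ.length = n), mu {X | pre X σ.length = σ} :=
        measure_biUnion_finset_le _ _
      _ ≤ ∑ σ ∈ (L.toFinset.filter fun σ => σ.length = n), (2 : ℝ≥0∞)⁻¹ ^ n := by
        refine Finset.sum_le_sum fun σ hσ => ?_
        rw [mu_pre, (Finset.mem_filter.1 hσ).2]
      _ ≤ L.length * (2 : ℝ≥0∞)⁻¹ ^ n := by
        rw [Finset.sum_const, nsmul_eq_mul]
        gcongr
        exact (Finset.card_filter_le _ _).trans (List.toFinset_card_le _)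
      _ ≤ (2 : ℝ≥0∞)⁻¹ ^ (q + (k + 1)) := by
        rw [← ENNReal.inv_pow, ← ENNReal.inv_pow, ← div_eq_mul_inv,
          ENNReal.div_le_iff (by simp) (by finiteness), mul_comm, ← div_eq_mul_inv,
          ENNReal.le_div_iff_mul_le (by simp) (by simp)]
        exact_mod_cast h2.le
  refine ⟨f 0, k + 1, ?_, ?_, ?_⟩
  · intro X hX
    rw [hidx] at hX
    by_contra h
    exact hX (.inl h)
  · let B : ℕ → Set (ℕ → Bool) := fun q =>
      if h : ∃ n, ∃ L, small q n L then {X | ¬ R (q, pre X (Nat.find h))} else ∅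
    obtain ⟨X, hX, hB⟩ := exists_avoid P B k hk (by
      intro q
      by_cases h : ∃ n, ∃ L, small q n L
      · obtain ⟨L, hL⟩ := Nat.find_spec h
        simp only [B, dif_pos h]
        exact hLev _ _ L hL
      · simp [B, dif_neg h])
    refine ⟨X, (hidx X 0).2 ?_⟩
    rintro (h | ⟨⟨q, n, L⟩, h1, h2⟩)
    · exact h hX
    · simp only at h1 h2
      have h : ∃ n, ∃ L, small q n L := ⟨n, L, h1⟩
      have := hB q
      simp only [B, dif_pos h] at this
      refine this fun h3 => h2 (M X q _ _ (Nat.find_min' h ⟨L, h1⟩) h3)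
  · intro q hq hne
    by_contra hlt
    rw [not_le] at hlt
    have h1 : Cl q = ⋂ n, {X | ¬ R (q, pre X n)} := by
      ext X
      have := H X trivial q
      simp only [Set.mem_iInter, Set.mem_ofPred_eq]
      rw [← not_exists, ← this, not_not]
    have hanti : Antitone fun n => {X | ¬ R (q, pre X n)} :=
      fun m n hmn X hX h => hX (M X q _ _ hmn h)
    rw [h1, hanti.measure_iInter (fun n => (measurable_pre (fun σ => ¬ R (q, σ)) n).nullMeasurableSet)
      ⟨0, measure_ne_top _ _⟩, iInf_lt_iff] at hlt
    obtain ⟨n, hn⟩ := hlt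
    have h2 : {X : ℕ → Bool | ¬ R (q, pre X n)} =
        {X | (fun f : Fin n → Bool => ¬ R (q, List.ofFn f)) (fun i : Fin n => X i.1)} := by
      ext X
      simp [pre_ofFn]
    rw [h2, mu_card n (fun f : Fin n → Bool => ¬ R (q, List.ofFn f)), Nat.card_eq_fintype_card, Fintype.card_subtype] at hn
    set F := Finset.univ.filter fun f : Fin n → Bool => ¬ R (q, List.ofFn f)
    have hs : small q n (F.toList.map List.ofFn) := by
      constructor
      · intro σ hσ
        rw [mem_strs] at hσ
        subst hσ
        by_cases h : R (q, σ)
        · exact .inl h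
        · refine .inr (List.mem_map.2 ⟨fun i => σ.get i, ?_, by simp⟩)
          simp [F, h]
      · simp only [List.length_map, Finset.length_toList]
        rw [← ENNReal.inv_pow, ENNReal.div_lt_iff (by simp) (by simp), mul_comm, ← div_eq_mul_inv,
          ENNReal.lt_div_iff_mul_lt (by simp) (by simp)] at hn
        exact_mod_cast hn
    obtain ⟨X, hX⟩ := hne
    refine (hidx X 0).1 (hq hX) (.inr ⟨(q, n, _), hs, ?_⟩)
    rw [h1] at hX
    exact Set.mem_iInter.1 hX n

end Part5

section Part6
/-! ## Thinning a class -/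

open MeasureTheory

theorem Sg.empty {S : Set (ℕ → Bool)} : Sg S (fun _ p => Cl p = ∅) :=
  (Sg.all_oracle Cl.sg).congr fun _ _ _ => Set.eq_empty_iff_forall_notMem

theorem Sg.empty_cyl {S : Set (ℕ → Bool)} :
    Sg S (fun _ (x : ℕ × List Bool) => Cl x.1 ∩ cyl x.2 = ∅) := by
  have h : Sg Set.univ (fun X (x : ℕ × List Bool) => X ∉ Cl x.1 ∨ ¬ pre X x.2.length = x.2) :=
    (Cl.sg.comp (f := fun x : ℕ × List Bool => x.1) (by fun_prop)).or
      (Sg.not_ext.comp (f := fun x : ℕ × List Bool => x.2) (by fun_prop))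
  refine (Sg.all_oracle h).congr fun _ _ x => ?_
  rw [Set.eq_empty_iff_forall_notMem]
  refine forall_congr' fun X => ?_
  simp only [Set.mem_inter_iff, cyl, Set.mem_ofPred_eq]
  tauto

theorem exists_thin (p0 c : ℕ) (hc : ∀ q, Cl q ⊆ Cl p0 → (Cl q).Nonempty →
      (2 : ℝ≥0∞)⁻¹ ^ (q + c) ≤ mu (Cl q)) :
    ∃ Q : ℕ → ℕ, Primrec Q ∧ ∀ p, Cl (Q p) ⊆ Cl p ∧
      (Cl p ⊆ Cl p0 → (Cl p).Nonempty → (Cl (Q p)).Nonempty) ∧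
      ∀ σ, (Cl p ∩ cyl σ).Nonempty →
        ∃ τ, σ <+: τ ∧ (Cl p ∩ cyl τ).Nonempty ∧ Cl (Q p) ∩ cyl τ = ∅ := by
  classical
  let len : ℕ → List Bool → ℕ := fun p σ => σ.length + (Encodable.encode σ + (p + c + 1 + 1))
  let bad : (ℕ → Bool) → ℕ → List Bool → Prop := fun X p σ =>
    pre X σ.length = σ ∧ ∀ τ ∈ strs (len p σ),
      Encodable.encode τ < Encodable.encode (pre X (len p σ)) → τ.take σ.length = σ →
      Cl p ∩ cyl τ = ∅
  have hlen : Primrec fun x : ℕ × List Bool => len x.1 x.2 := by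
    change Primrec fun x : ℕ × List Bool => x.2.length + (Encodable.encode x.2 + (x.1 + c + 1 + 1))
    fun_prop
  have hbad : Sg Set.univ (fun X (x : ℕ × List Bool) => bad X x.1 x.2) := by
    refine Sg.and ?_ ?_
    · exact Sg.of_pre (Q := fun y : (ℕ × List Bool) × List Bool => y.2 = y.1.2)
        (pp_eq (by fun_prop) (by fun_prop)) (f := fun x => x.2.length) (by fun_prop)
    · refine Sg.all_mem (p := fun X (x : ℕ × List Bool) τ =>
        Encodable.encode τ < Encodable.encode (pre X (len x.1 x.2)) → τ.take x.2.length = x.2 →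
        Cl x.1 ∩ cyl τ = ∅) (f := fun x : ℕ × List Bool => strs (len x.1 x.2)) ?_ (pr_strs hlen)
      have h1 : Sg Set.univ (fun X (y : (ℕ × List Bool) × List Bool) =>
          ¬ Encodable.encode y.2 < Encodable.encode (pre X (len y.1.1 y.1.2))) :=
        Sg.of_pre (Q := fun z : ((ℕ × List Bool) × List Bool) × List Bool =>
          ¬ Encodable.encode z.1.2 < Encodable.encode z.2)
          (pp_lt (by fun_prop) (by fun_prop)).not
          (f := fun y : (ℕ × List Bool) × List Bool => len y.1.1 y.1.2)
          (hlen.comp (f := fun x : ℕ × List Bool => len x.1 x.2) (g := fun y : (ℕ × List Bool) × List Bool => y.1) (by fun_prop))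
      have h2 : Sg Set.univ (fun _ (y : (ℕ × List Bool) × List Bool) =>
          ¬ y.2.take y.1.2.length = y.1.2) :=
        Sg.of_pred (pp_eq (by fun_prop) (by fun_prop)).not
      have h3 : Sg Set.univ (fun _ (y : (ℕ × List Bool) × List Bool) =>
          Cl y.1.1 ∩ cyl y.2 = ∅) :=
        Sg.empty_cyl.comp (f := fun y : (ℕ × List Bool) × List Bool => (y.1.1, y.2)) (by fun_prop)
      refine (h1.or (h2.or h3)).congr fun X _ y => ?_
      tauto
  have hq : Sg Set.univ (fun X p => X ∉ Cl p ∨ ∃ σ, bad X p σ) :=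
    Cl.sg.or (Sg.ex (p := fun X (p : ℕ) σ => bad X p σ) hbad)
  obtain ⟨Q, hQ, hidx⟩ := Cl.index hq
  refine ⟨Q, hQ, fun p => ⟨?_, ?_, ?_⟩⟩
  · intro X hX
    rw [hidx] at hX
    by_contra h
    exact hX (.inl h)
  · intro hp hne
    have hlow := hc p hp hne
    let B : ℕ → Set (ℕ → Bool) := fun i =>
      {X | X ∈ Cl p ∧ ∃ σ : List Bool, Encodable.encode σ = i ∧ bad X p σ}
    obtain ⟨X, hX, hB⟩ := exists_avoid (Cl p) B (p + c + 1) (by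
      refine lt_of_lt_of_le ?_ hlow
      rw [← ENNReal.inv_pow, ← ENNReal.inv_pow, ENNReal.inv_lt_inv]
      exact_mod_cast Nat.pow_lt_pow_right (by norm_num) (by omega)) (by
      intro i
      by_cases hBne : (B i).Nonempty
      · obtain ⟨Y, hY, σ, hσ, hYσ⟩ := hBne
        have hsub : B i ⊆ {X | pre X (pre Y (len p σ)).length = pre Y (len p σ)} := by
          rintro Z ⟨hZ, σ', hσ', hZσ⟩
          obtain rfl := Encodable.encode_injective (hσ'.trans hσ.symm)
          have hle : σ'.length ≤ len p σ' := by simp [len]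
          simp only [Set.mem_ofPred_eq, pre_length]
          by_contra hne
          have hne' : Encodable.encode (pre Z (len p σ')) ≠ Encodable.encode (pre Y (len p σ')) :=
            fun h => hne (Encodable.encode_injective h)
          rcases lt_or_gt_of_ne hne' with h | h
          · have := hYσ.2 _ (mem_strs.2 (by simp)) h (by rw [pre_take Z hle]; exact hZσ.1)
            exact Set.notMem_empty Z (this ▸ ⟨hZ, by simp [cyl]⟩)
          · have := hZσ.2 _ (mem_strs.2 (by simp)) h (by rw [pre_take Y hle]; exact hYσ.1)
            exact Set.notMem_empty Y (this ▸ ⟨hY, by simp [cyl]⟩)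
        refine (measure_mono hsub).trans ?_
        rw [mu_pre, pre_length]
        refine pow_le_pow_of_le_one (by simp) (by simp) ?_
        simp only [len, hσ]
        omega
      · rw [Set.not_nonempty_iff_eq_empty.1 hBne]; simp)
    refine ⟨X, (hidx X p).2 ?_⟩
    rintro (h | ⟨σ, h⟩)
    · exact h hX
    · exact hB _ ⟨hX, σ, rfl, h⟩
  · rintro σ ⟨X, hX, hXσ⟩
    have hle : σ.length ≤ len p σ := by simp [len]
    have hex : ∃ N, ∃ τ : List Bool, Encodable.encode τ = N ∧ τ.length = len p σ ∧
        τ.take σ.length = σ ∧ (Cl p ∩ cyl τ).Nonempty :=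
      ⟨_, pre X (len p σ), rfl, by simp, by rw [pre_take X hle]; exact hXσ, X, hX, by simp [cyl]⟩
    obtain ⟨τ, hτ, hlen, htake, hne⟩ := Nat.find_spec hex
    refine ⟨τ, List.prefix_iff_eq_take.2 htake.symm, hne, ?_⟩
    rw [Set.eq_empty_iff_forall_notMem]
    rintro Y ⟨hY, hYτ⟩
    have hYτ' : pre Y (len p σ) = τ := by rw [← hlen]; exact hYτ
    refine (hidx Y p).1 hY (.inr ⟨σ, ?_, ?_⟩)
    · rw [← pre_take Y hle, hYτ', htake]
    · intro ρ hρ hlt htk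
      rw [mem_strs] at hρ
      rw [hYτ', hτ] at hlt
      by_contra hcon
      exact Nat.find_min hex hlt ⟨ρ, rfl, hρ, htk, Set.nonempty_iff_ne_empty.2 hcon⟩

/-- The conditions used in the construction. -/
theorem exists_forcing (T : List Bool → Bool)
    (hT : ∃ c : OracleCode, ComputesFun c T) (htree : IsTree T)
    (hpos : 0 < cantorMeasure (pathsOf T)) :
    ∃ p0 : ℕ, ∃ Q : ℕ → ℕ, Cl p0 ⊆ pathsOf T ∧ (Cl p0).Nonempty ∧ Primrec Q ∧
      ∀ p, Cl (Q p) ⊆ Cl p ∧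
      (Cl p ⊆ Cl p0 → (Cl p).Nonempty → (Cl (Q p)).Nonempty) ∧
      ∀ σ, (Cl p ∩ cyl σ).Nonempty →
        ∃ τ, σ <+: τ ∧ (Cl p ∩ cyl τ).Nonempty ∧ Cl (Q p) ∩ cyl τ = ∅ := by
  have hsg : Sg Set.univ fun X (_ : ℕ) => X ∉ pathsOf T := by
    obtain ⟨c, hc⟩ := hT
    have h1 : Sg {fun _ => false} (fun _ (σ : List Bool) => T σ = false) := by
      refine ((Ev.sg.subset (S' := {fun _ => false}) (by simp)).comp
        (f := fun σ : List Bool => (c.encodeCode, Encodable.encode σ, 0)) (by fun_prop)).congr ?_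
      rintro X hX σ
      obtain rfl : X = fun _ => false := hX
      constructor
      · intro h
        refine ⟨c, rfl, ?_⟩
        rw [hc σ, h]
        exact Part.mem_some _
      · rintro ⟨d, hd, h⟩
        rw [encodeCode_inj _ _ hd, hc σ] at h
        have := Part.mem_some_iff.1 h
        cases hTσ : T σ
        · rfl
        · simp [hTσ] at this
    have h2 : Sg Set.univ (fun X (_ : ℕ) => ∃ σ : List Bool, pre X σ.length = σ ∧ T σ = false) := by
      refine Sg.ex (p := fun X (_ : ℕ) (σ : List Bool) => pre X σ.length = σ ∧ T σ = false) ?_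
      refine Sg.and ?_ ?_
      · exact Sg.of_pre (Q := fun y : (ℕ × List Bool) × List Bool => y.2 = y.1.2)
          (pp_eq (by fun_prop) (by fun_prop)) (f := fun x => x.2.length) (by fun_prop)
      · exact (Sg.of_zero h1).comp (f := fun x : ℕ × List Bool => x.2) (by fun_prop)
    refine h2.congr fun X _ _ => ?_
    simp only [pathsOf, Set.mem_ofPred_eq, pre_ofFn, not_forall]
    constructor
    · rintro ⟨n, hn⟩
      exact ⟨pre X n, by simp, by simpa using hn⟩
    · rintro ⟨σ, h1, h2⟩
      exact ⟨σ.length, by rw [h1]; simp [h2]⟩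
  obtain ⟨p0, c, h1, h2, h3⟩ := exists_base (pathsOf T) hsg (mu_paths_pos T htree hpos)
  obtain ⟨Q, hQ, h4⟩ := exists_thin p0 c h3
  exact ⟨p0, Q, h1, h2, hQ, h4⟩

end Part6

section Part7
/-! ## The construction -/

theorem TRed.sg_trans {Z X Y : ℕ → Bool} (h : TRed Z X) (h' : TRed X Y) : TRed Z Y :=
  TRed.iff_sg.2 ((TRed.iff_sg.1 h').trans (TRed.iff_sg.1 h))

theorem TRed.jump_self (X : ℕ → Bool) : TRed X (jump X) := by
  rw [TRed.iff_sg]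
  refine Sg.jump_pos (p := fun a : ℕ × Bool => X a.1 = a.2) ?_
  refine Sg.bit.congr ?_
  rintro _ rfl a
  rfl

theorem TRed.zero (X : ℕ → Bool) : TRed (fun _ => false) X := by
  rw [TRed.iff_sg]
  exact Sg.of_pred (p := fun a : ℕ × Bool => false = a.2) (pp_eq (by fun_prop) (by fun_prop))

theorem TRed.zeroJump_jump (X : ℕ → Bool) : TRed zeroJump (jump X) := Sg.mono_jump (TRed.zero X)

theorem construct (p0 : ℕ) (Q : ℕ → ℕ) (hne : (Cl p0).Nonempty) (hQ : Primrec Q)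
    (hQs : ∀ p, Cl (Q p) ⊆ Cl p ∧ (Cl p ⊆ Cl p0 → (Cl p).Nonempty → (Cl (Q p)).Nonempty))
    (D : ℕ × ℕ → ℕ → Prop) (hD : Sg {zeroJump} fun _ (x : (ℕ × ℕ) × ℕ) => D x.1 x.2)
    (hD1 : ∀ a w, D a w → Cl w ⊆ Cl a.2 ∧ (Cl w).Nonempty ∧ Cl (Q a.2) ∩ Cl w = ∅) :
    ∃ A ∈ Cl p0, ∃ g : ℕ → ℕ, (∀ s, A ∈ Cl (g s)) ∧
      (∀ s, (∃ w, D (s, g s) w) → D (s, g s) (g (s + 1))) ∧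
      (∀ s, ¬ (∃ w, D (s, g s) w) → A ∈ Cl (Q (g s))) ∧
      ∀ O, (O = jump A ∨ O = jump zeroJump) →
        Sg {O} (fun _ s => ∃ w, D (s, g s) w) ∧ Sg {O} (fun _ s => ¬ ∃ w, D (s, g s) w) := by
  classical
  obtain ⟨G, hG, hGD, hDG, hGu⟩ := hD.unif
  let step : ℕ → ℕ → ℕ := fun s p => if h : ∃ w, G (s, p) w then h.choose else Q p
  let g : ℕ → ℕ := fun s => Nat.rec p0 step s
  have hgs : ∀ s, g (s + 1) = step s (g s) := fun s => rfl
  have hyes : ∀ s, (∃ w, D (s, g s) w) → G (s, g s) (g (s + 1)) := by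
    intro s h
    have h' := hDG _ h
    have : g (s + 1) = h'.choose := by
      rw [hgs]
      exact dif_pos h'
    rw [this]
    exact h'.choose_spec
  have hno : ∀ s, ¬ (∃ w, D (s, g s) w) → g (s + 1) = Q (g s) := by
    intro s h
    rw [hgs]
    exact dif_neg fun ⟨w, hw⟩ => h ⟨w, hGD _ _ hw⟩
  have hsub : ∀ s, Cl (g (s + 1)) ⊆ Cl (g s) := by
    intro s
    by_cases h : ∃ w, D (s, g s) w
    · exact (hD1 _ _ (hGD _ _ (hyes s h))).1
    · rw [hno s h]
      exact (hQs _).1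
  have hinv : ∀ s, Cl (g s) ⊆ Cl p0 ∧ (Cl (g s)).Nonempty := by
    intro s
    induction s with
    | zero => exact ⟨le_rfl, hne⟩
    | succ s ih =>
      refine ⟨(hsub s).trans ih.1, ?_⟩
      by_cases h : ∃ w, D (s, g s) w
      · exact (hD1 _ _ (hGD _ _ (hyes s h))).2.1
      · rw [hno s h]
        exact (hQs _).2 ih.1 ih.2
  obtain ⟨A, hA⟩ := IsCompact.nonempty_iInter_of_sequence_nonempty_isCompact_isClosed
    (fun s => Cl (g s)) hsub (fun s => (hinv s).2) (Cl.isClosed _).isCompact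
    (fun s => Cl.isClosed _)
  rw [Set.mem_iInter] at hA
  have hnoA : ∀ s, ¬ (∃ w, D (s, g s) w) → A ∈ Cl (Q (g s)) := by
    intro s h
    rw [← hno s h]
    exact hA (s + 1)
  refine ⟨A, hA 0, g, hA, fun s h => hGD _ _ (hyes s h), hnoA, ?_⟩
  have main : ∀ (O : ℕ → Bool) (N : ℕ × ℕ → Prop), TRed zeroJump O → Sg {O} (fun _ a => N a) →
      (∀ s, N (s, g s) ↔ ¬ ∃ w, D (s, g s) w) →
      Sg {O} (fun _ s => ∃ w, D (s, g s) w) ∧ Sg {O} (fun _ s => ¬ ∃ w, D (s, g s) w) := by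
    intro O N hO hN hNs
    have hG' := (TRed.iff_sg.1 hO).trans hG
    have hD' := (TRed.iff_sg.1 hO).trans hD
    have hgr : Sg {O} (fun _ (x : ℕ × ℕ) => g x.1 = x.2) := by
      refine Sg.rec_graph (Gr := fun s p v => G (s, p) v ∨ (N (s, p) ∧ v = Q p)) ?_ ?_
      · refine Sg.or ?_ (Sg.and ?_ ?_)
        · exact hG'.comp (f := fun x : ℕ × ℕ × ℕ => ((x.1, x.2.1), x.2.2)) (by fun_prop)
        · exact hN.comp (f := fun x : ℕ × ℕ × ℕ => (x.1, x.2.1)) (by fun_prop)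
        · exact Sg.of_pred (p := fun x : ℕ × ℕ × ℕ => x.2.2 = Q x.2.1)
            (pp_eq (by fun_prop) (by fun_prop))
      · intro s v
        by_cases h : ∃ w, D (s, g s) w
        · have h1 := hyes s h
          constructor
          · rintro (h2 | ⟨h2, -⟩)
            · exact hGu _ _ _ h2 h1
            · exact absurd h ((hNs s).1 h2)
          · rintro rfl
            exact .inl h1
        · rw [hno s h]
          constructor
          · rintro (h2 | ⟨-, h2⟩)
            · exact absurd ⟨_, hGD _ _ h2⟩ h
            · exact h2
          · intro h2
            exact .inr ⟨(hNs s).2 h, h2⟩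
    constructor
    · have : Sg {O} (fun _ s => ∃ x : ℕ × ℕ, g s = x.1 ∧ D (s, x.1) x.2) := by
        refine Sg.ex (p := fun _ (s : ℕ) (x : ℕ × ℕ) => g s = x.1 ∧ D (s, x.1) x.2) (Sg.and ?_ ?_)
        · exact hgr.comp (f := fun y : ℕ × ℕ × ℕ => (y.1, y.2.1)) (by fun_prop)
        · exact hD'.comp (f := fun y : ℕ × ℕ × ℕ => ((y.1, y.2.1), y.2.2)) (by fun_prop)
      refine this.congr fun _ _ s => ?_
      constructor
      · rintro ⟨w, h⟩
        exact ⟨(_, w), rfl, h⟩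
      · rintro ⟨⟨p, w⟩, rfl, h⟩
        exact ⟨w, h⟩
    · have : Sg {O} (fun _ s => ∃ x : ℕ, g s = x ∧ N (s, x)) := by
        refine Sg.ex (p := fun _ (s : ℕ) (x : ℕ) => g s = x ∧ N (s, x)) (Sg.and ?_ ?_)
        · exact hgr.comp (f := fun y : ℕ × ℕ => (y.1, y.2)) (by fun_prop)
        · exact hN.comp (f := fun y : ℕ × ℕ => (y.1, y.2)) (by fun_prop)
      refine this.congr fun _ _ s => ?_
      beta_reduce
      rw [← hNs]
      constructor
      · intro h
        exact ⟨_, rfl, h⟩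
      · rintro ⟨p, rfl, h⟩
        exact h
  rintro O (rfl | rfl)
  · refine main _ (fun a => A ∈ Cl (Q a.2)) (TRed.zeroJump_jump A) ?_ ?_
    · have h1 : Sg {A} (fun _ (a : ℕ × ℕ) => A ∉ Cl (Q a.2)) := by
        refine ((Cl.sg.subset (S' := {A}) (by simp)).comp
          (f := fun a : ℕ × ℕ => Q a.2) (by fun_prop)).congr ?_
        rintro _ rfl a
        rfl
      refine h1.jump_neg.congr fun _ _ a => ?_
      rw [not_not]
    · intro s
      refine ⟨fun h h' => ?_, hnoA s⟩
      have h2 := (hD1 _ _ (hGD _ _ (hyes s h'))).2.2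
      exact Set.notMem_empty A (h2 ▸ ⟨h, hA (s + 1)⟩)
  · refine main _ (fun a => ¬ ∃ w, D a w) (TRed.jump_self _) ?_ fun s => Iff.rfl
    exact Sg.jump_neg (p := fun a : ℕ × ℕ => ∃ w, D a w)
      (Sg.ex (p := fun _ (a : ℕ × ℕ) w => D a w) hD)

/-! ## Forcing the jump of a join -/

def mix (σ τ : List Bool) : List Bool :=
  (List.range σ.length).map fun i =>
    if i % 2 = 0 then (σ[i / 2]?).getD false else (τ[i / 2]?).getD false

theorem mix_primrec : Primrec fun x : List Bool × List Bool => mix x.1 x.2 := by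
  unfold mix
  refine Primrec.list_map (by fun_prop) ?_
  unfold Primrec₂
  exact Primrec.ite (pp_eq (by fun_prop) (by fun_prop)) (by fun_prop) (by fun_prop)

theorem mix_pre (A B : ℕ → Bool) (k : ℕ) : mix (pre A k) (pre B k) = pre (join A B) k := by
  unfold mix
  conv_rhs => unfold pre
  rw [pre_length]
  refine List.map_congr_left fun i hi => ?_
  have hi : i < k := by simpa using hi
  rw [pre_get A (by omega), pre_get B (by omega)]
  simp [join]

theorem exists_join (B : ℕ → Bool) : ∃ S : ℕ × List Bool → Prop, Sg {B} (fun _ x => S x) ∧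
    (∀ A e, jump (join A B) e = true ↔ ∃ k, S (e, pre A k)) ∧
    ∀ A e j k, j ≤ k → S (e, pre A j) → S (e, pre A k) := by
  obtain ⟨R, hR, H, M⟩ := jump_sg.mono
  refine ⟨fun x => R (x.1, mix x.2 (pre B x.2.length)), ?_, ?_, ?_⟩
  · have h : Sg {B} (fun X (x : ℕ × List Bool) => R (x.1, mix x.2 (pre X x.2.length))) := by
      refine Sg.of_pre (Q := fun y : (ℕ × List Bool) × List Bool => R (y.1.1, mix y.1.2 y.2))
        (hR.comp ?_) (f := fun x : ℕ × List Bool => x.2.length) (by fun_prop)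
      exact pr_pair (by fun_prop) (mix_primrec.comp
        (g := fun y : (ℕ × List Bool) × List Bool => (y.1.2, y.2)) (by fun_prop))
    refine h.congr ?_
    rintro _ rfl x
    rfl
  · intro A e
    rw [H _ trivial]
    simp only [pre_length, mix_pre]
  · intro A e j k hjk
    simp only [pre_length, mix_pre]
    exact M _ _ _ _ hjk

end Part7

section Part8
theorem cyl_mono {σ τ : List Bool} (h : σ <+: τ) : cyl τ ⊆ cyl σ := by
  intro X hX
  have hX : pre X τ.length = τ := hX
  change pre X σ.length = σ
  rw [← pre_take X h.length_le, hX]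
  exact (List.prefix_iff_eq_take.1 h).symm

theorem exists_F0 : ∃ F : ℕ × List Bool → ℕ, Primrec F ∧ ∀ x, Cl (F x) = Cl x.1 ∩ cyl x.2 := by
  have h : Sg Set.univ (fun X (x : ℕ × List Bool) => X ∉ Cl x.1 ∨ ¬ pre X x.2.length = x.2) :=
    (Cl.sg.comp (f := fun x : ℕ × List Bool => x.1) (by fun_prop)).or
      (Sg.not_ext.comp (f := fun x : ℕ × List Bool => x.2) (by fun_prop))
  obtain ⟨F, hF, H⟩ := Cl.index h
  refine ⟨F, hF, fun x => ?_⟩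
  ext X
  rw [H]
  simp only [Set.mem_inter_iff, cyl, Set.mem_ofPred_eq]
  tauto

theorem exists_F1 : ∃ F : (ℕ × List Bool) × ℕ × ℕ × ℕ → ℕ, Primrec F ∧
    ∀ x X, X ∈ Cl (F x) ↔ X ∈ Cl x.1.1 ∧ X ∈ cyl x.1.2 ∧ ¬ Ev X x.2.1 x.2.2.1 x.2.2.2 := by
  have h : Sg Set.univ (fun X (x : (ℕ × List Bool) × ℕ × ℕ × ℕ) =>
      (X ∉ Cl x.1.1 ∨ ¬ pre X x.1.2.length = x.1.2) ∨ Ev X x.2.1 x.2.2.1 x.2.2.2) :=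
    ((Cl.sg.comp (f := fun x : (ℕ × List Bool) × ℕ × ℕ × ℕ => x.1.1) (by fun_prop)).or
      (Sg.not_ext.comp (f := fun x : (ℕ × List Bool) × ℕ × ℕ × ℕ => x.1.2) (by fun_prop))).or
      (Ev.sg.comp (f := fun x : (ℕ × List Bool) × ℕ × ℕ × ℕ => x.2) (by fun_prop))
  obtain ⟨F, hF, H⟩ := Cl.index h
  refine ⟨F, hF, fun x X => ?_⟩
  rw [H]
  simp only [cyl, Set.mem_ofPred_eq]
  tauto

theorem TRed.join_left (A B : ℕ → Bool) : TRed A (join A B) := by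
  rw [TRed.iff_sg]
  refine ((Sg.bit (S := {join A B})).comp
    (f := fun a : ℕ × Bool => (2 * a.1, a.2)) (by fun_prop)).congr ?_
  rintro _ rfl a
  simp [join]

theorem TRed.join_right (A B : ℕ → Bool) : TRed B (join A B) := by
  rw [TRed.iff_sg]
  refine ((Sg.bit (S := {join A B})).comp
    (f := fun a : ℕ × Bool => (2 * a.1 + 1, a.2)) (by fun_prop)).congr ?_
  rintro _ rfl a
  have h1 : (2 * a.1 + 1) % 2 = 1 := by omega
  have h2 : (2 * a.1 + 1) / 2 = a.1 := by omega
  simp [join, h1, h2]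

theorem Ev.val {X Z : ℕ → Bool} {c : OracleCode} (h : c.eval (chi X) = chi Z) (n v : ℕ) :
    Ev X c.encodeCode n v ↔ v = cond (Z n) 1 0 := by
  constructor
  · rintro ⟨d, hd, hv⟩
    rw [encodeCode_inj _ _ hd, h] at hv
    exact Part.mem_some_iff.1 hv
  · rintro rfl
    exact ⟨c, rfl, by rw [h]; exact Part.mem_some _⟩

theorem main_theorem (T : List Bool → Bool)
    (hT : ∃ c : OracleCode, ComputesFun c T) (htree : IsTree T)
    (hpos : 0 < cantorMeasure (pathsOf T)) :
    ∃ A ∈ pathsOf T,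
      TEquiv (jump A) (jump (join A zeroJump)) ∧
      ¬ ComputableSeq A ∧
      (∀ Z : ℕ → Bool, TRed Z A → TRed Z zeroJump → ComputableSeq Z) ∧
      TRed A (jump zeroJump) := by
  obtain ⟨p0, Q, hp0, hne, hQ, hQs⟩ := exists_forcing T hT htree hpos
  obtain ⟨S, hS, hSj, hSm⟩ := exists_join zeroJump
  obtain ⟨F0, hF0, hF0c⟩ := exists_F0
  obtain ⟨F1, hF1, hF1c⟩ := exists_F1
  let D : ℕ × ℕ → ℕ → Prop := fun a w => ¬ Cl w = ∅ ∧ ∃ u : List Bool × ℕ × ℕ,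
    Cl (Q a.2) ∩ cyl u.1 = ∅ ∧
      ((a.1 % 2 = 0 ∧ S (a.1 / 2, u.1) ∧ w = F0 (a.2, u.1)) ∨
       (a.1 % 2 = 1 ∧ Ev zeroJump (a.1 / 2).unpair.2 u.2.1 u.2.2 ∧
          w = F1 ((a.2, u.1), (a.1 / 2).unpair.1, u.2.1, u.2.2)))
  have hD : Sg {zeroJump} fun _ (x : (ℕ × ℕ) × ℕ) => D x.1 x.2 := by
    refine Sg.and ?_ ?_
    · have h : Sg {zeroJump} fun _ p => ¬ Cl p = ∅ :=
        Sg.jump_neg (X := fun _ => false) (p := fun p => Cl p = ∅) Sg.empty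
      exact h.comp (f := fun x : (ℕ × ℕ) × ℕ => x.2) (by fun_prop)
    · refine Sg.ex (p := fun _ (x : (ℕ × ℕ) × ℕ) (u : List Bool × ℕ × ℕ) =>
        Cl (Q x.1.2) ∩ cyl u.1 = ∅ ∧
        ((x.1.1 % 2 = 0 ∧ S (x.1.1 / 2, u.1) ∧ x.2 = F0 (x.1.2, u.1)) ∨
         (x.1.1 % 2 = 1 ∧ Ev zeroJump (x.1.1 / 2).unpair.2 u.2.1 u.2.2 ∧
          x.2 = F1 ((x.1.2, u.1), (x.1.1 / 2).unpair.1, u.2.1, u.2.2)))) ?_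
      refine Sg.and ?_ (Sg.or (Sg.and ?_ (Sg.and ?_ ?_)) (Sg.and ?_ (Sg.and ?_ ?_)))
      · exact Sg.empty_cyl.comp (f := fun y : ((ℕ × ℕ) × ℕ) × List Bool × ℕ × ℕ =>
          (Q y.1.1.2, y.2.1)) (by fun_prop)
      · exact Sg.of_pred (p := fun y : ((ℕ × ℕ) × ℕ) × List Bool × ℕ × ℕ => y.1.1.1 % 2 = 0)
          (pp_eq (by fun_prop) (by fun_prop))
      · exact hS.comp (f := fun y : ((ℕ × ℕ) × ℕ) × List Bool × ℕ × ℕ =>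
          (y.1.1.1 / 2, y.2.1)) (by fun_prop)
      · exact Sg.of_pred (p := fun y : ((ℕ × ℕ) × ℕ) × List Bool × ℕ × ℕ =>
          y.1.2 = F0 (y.1.1.2, y.2.1)) (pp_eq (by fun_prop) (by fun_prop))
      · exact Sg.of_pred (p := fun y : ((ℕ × ℕ) × ℕ) × List Bool × ℕ × ℕ => y.1.1.1 % 2 = 1)
          (pp_eq (by fun_prop) (by fun_prop))
      · refine ((Ev.sg.subset (S' := {zeroJump}) (by simp)).comp
          (f := fun y : ((ℕ × ℕ) × ℕ) × List Bool × ℕ × ℕ =>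
            ((y.1.1.1 / 2).unpair.2, y.2.2.1, y.2.2.2)) (by fun_prop)).congr ?_
        rintro _ rfl y
        rfl
      · exact Sg.of_pred (p := fun y : ((ℕ × ℕ) × ℕ) × List Bool × ℕ × ℕ =>
          y.1.2 = F1 ((y.1.1.2, y.2.1), (y.1.1.1 / 2).unpair.1, y.2.2.1, y.2.2.2))
          (pp_eq (by fun_prop) (by fun_prop))
  have hD1 : ∀ a w, D a w → Cl w ⊆ Cl a.2 ∧ (Cl w).Nonempty ∧ Cl (Q a.2) ∩ Cl w = ∅ := by
    rintro a w ⟨h1, u, h2, h3⟩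
    have h4 : Cl w ⊆ Cl a.2 ∧ Cl w ⊆ cyl u.1 := by
      rcases h3 with ⟨-, -, rfl⟩ | ⟨-, -, rfl⟩
      · rw [hF0c]
        exact ⟨Set.inter_subset_left, Set.inter_subset_right⟩
      · exact ⟨fun X hX => ((hF1c _ _).1 hX).1, fun X hX => ((hF1c _ _).1 hX).2.1⟩
    refine ⟨h4.1, Set.nonempty_iff_ne_empty.2 h1, ?_⟩
    rw [Set.eq_empty_iff_forall_notMem]
    rintro X ⟨hX, hX'⟩
    exact Set.notMem_empty X (h2 ▸ ⟨hX, h4.2 hX'⟩)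
  obtain ⟨A, hA0, g, hA, hyes, hno, hO⟩ :=
    construct p0 Q hne hQ (fun p => ⟨(hQs p).1, (hQs p).2.1⟩) D hD hD1
  -- the jump of the join is decided along the construction
  have hjoin : ∀ e, jump (join A zeroJump) e = true ↔ ∃ w, D (2 * e, g (2 * e)) w := by
    intro e
    have e1 : 2 * e / 2 = e := by omega
    constructor
    · intro h
      by_contra hcon
      have hAQ := hno _ hcon
      obtain ⟨k, hk⟩ := (hSj A e).1 h
      obtain ⟨τ, hτ, ⟨X, hX, hXτ⟩, hdis⟩ := (hQs (g (2 * e))).2.2 (pre A k)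
        ⟨A, hA _, by simp [cyl]⟩
      refine hcon ⟨F0 (g (2 * e), τ), ?_, (τ, 0, 0), hdis, .inl ⟨by simp, ?_, rfl⟩⟩
      · rw [hF0c]
        exact Set.nonempty_iff_ne_empty.1 ⟨X, hX, hXτ⟩
      · simp only [e1]
        have h1 : pre X τ.length = τ := hXτ
        have h2 : pre X k = pre A k := by
          have := cyl_mono hτ hXτ
          simpa [cyl] using this
        have h3 : k ≤ τ.length := by simpa using hτ.length_le
        have := hSm X e k τ.length h3 (by rw [h2]; exact hk)
        rwa [h1] at this
    · intro h
      obtain ⟨-, u, -, h3⟩ := hyes _ h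
      rcases h3 with ⟨-, h4, h5⟩ | ⟨h4, -⟩
      · have hAg := hA (2 * e + 1)
        rw [h5, hF0c] at hAg
        have h6 : pre A u.1.length = u.1 := hAg.2
        rw [hSj]
        refine ⟨u.1.length, ?_⟩
        rw [h6]
        simpa only [e1] using h4
      · simp at h4
  have hred : ∀ O, (O = jump A ∨ O = jump zeroJump) → TRed (jump (join A zeroJump)) O := by
    intro O h
    obtain ⟨h1, h2⟩ := hO O h
    refine TRed.of_sg ?_ ?_
    · exact (h1.comp (f := fun e : ℕ => 2 * e) (by fun_prop)).congr fun _ _ e => hjoin e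
    · exact (h2.comp (f := fun e : ℕ => 2 * e) (by fun_prop)).congr fun _ _ e =>
        not_congr (hjoin e)
  have hAj : TRed (jump (join A zeroJump)) (jump A) := hred _ (.inl rfl)
  refine ⟨A, hp0 hA0, ⟨Sg.mono_jump (TRed.join_left _ _), hAj⟩, ?_, ?_, ?_⟩
  · intro hc
    have h1 : TRed (jump A) zeroJump := Sg.mono_jump hc
    have h2 : TRed (jump (join A zeroJump)) (join A zeroJump) :=
      (hAj.sg_trans h1).sg_trans (TRed.join_right _ _)
    refine jump_diag (join A zeroJump) ?_
    refine ((TRed.iff_sg.1 h2).comp (f := fun n : ℕ => (n, false)) (by fun_prop)).congr ?_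
    intro _ _ n
    simp
  · rintro Z ⟨c, hc⟩ ⟨d, hd⟩
    let s := 2 * Nat.pair c.encodeCode d.encodeCode + 1
    have s1 : s % 2 = 1 := by simp only [s]; omega
    have s2 : s / 2 = Nat.pair c.encodeCode d.encodeCode := by simp only [s]; omega
    by_cases h : ∃ w, D (s, g s) w
    · exfalso
      obtain ⟨-, u, -, h3⟩ := hyes _ h
      rcases h3 with ⟨h4, -⟩ | ⟨-, h4, h5⟩
      · simp only at h4
        omega
      · have hAg := hA (s + 1)
        rw [h5, hF1c] at hAg
        have h6 := hAg.2.2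
        simp only [s2, Nat.unpair_pair] at h4 h6
        rw [Ev.val hd] at h4
        rw [Ev.val hc] at h6
        exact h6 h4
    · obtain ⟨τ, -, hτne, hdis⟩ := (hQs (g s)).2.2 [] ⟨A, hA _, by simp [cyl, pre]⟩
      have key : ∀ n b, Z n = b ↔
          Cl (F1 ((g s, τ), c.encodeCode, n, cond b 1 0)) = ∅ := by
        intro n b
        constructor
        · intro hb
          by_contra hcon
          refine h ⟨_, hcon, (τ, n, cond b 1 0), hdis, .inr ⟨s1, ?_, ?_⟩⟩
          · simp only [s2, Nat.unpair_pair]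
            rw [Ev.val hd, hb]
          · simp only [s2, Nat.unpair_pair]
        · intro hemp
          by_contra hb
          -- the value forced above `τ` is also not the true one
          have hZ : ¬ ¬ Cl (F1 ((g s, τ), c.encodeCode, n, cond (Z n) 1 0)) = ∅ := by
            intro hcon
            refine h ⟨_, hcon, (τ, n, cond (Z n) 1 0), hdis, .inr ⟨s1, ?_, ?_⟩⟩
            · simp only [s2, Nat.unpair_pair]
              rw [Ev.val hd]
            · simp only [s2, Nat.unpair_pair]
          rw [not_not] at hZ
          obtain ⟨X, hX, hXτ⟩ := hτne
          have ev : ∀ v, Cl (F1 ((g s, τ), c.encodeCode, n, v)) = ∅ → Ev X c.encodeCode n v := by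
            intro v hv
            by_contra hcon
            exact Set.notMem_empty X (hv ▸ (hF1c _ _).2 ⟨hX, hXτ, hcon⟩)
          obtain ⟨c1, hc1, hv1⟩ := ev _ hemp
          obtain ⟨c2, hc2, hv2⟩ := ev _ hZ
          obtain rfl := encodeCode_inj _ _ hc1
          obtain rfl := encodeCode_inj _ _ hc2
          have := Part.mem_unique hv1 hv2
          revert this hb
          cases b <;> cases Z n <;> simp
      refine TRed.iff_sg.2 ?_
      refine (Sg.empty.comp (f := fun a : ℕ × Bool =>
        F1 ((g s, τ), c.encodeCode, a.1, cond a.2 1 0)) (by fun_prop)).congr ?_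
      intro _ _ a
      exact key a.1 a.2
  · exact ((TRed.join_left A zeroJump).sg_trans (TRed.jump_self _)).sg_trans (hred _ (.inr rfl))

end Part8

/-- every `Π⁰₁` class of positive measure contains a member `A`
which is generalized high (`A' ≡_T (A ⊕ ∅')'`), forms a minimal pair with `∅'`,
and satisfies `A ≤_T ∅''`. -/
theorem gh_minimal_pair_with_jump_in_pi01_class (T : List Bool → Bool)
    (hT : ∃ c : OracleCode, ComputesFun c T) (htree : IsTree T)
    (hpos : 0 < cantorMeasure (pathsOf T)) :
    ∃ A ∈ pathsOf T,
      TEquiv (jump A) (jump (join A zeroJump)) ∧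
      ¬ ComputableSeq A ∧
      (∀ Z : ℕ → Bool, TRed Z A → TRed Z zeroJump → ComputableSeq Z) ∧
      TRed A (jump zeroJump) := by
  exact main_theorem T hT htree hpos

end TypicalDegree
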